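/- There is an absolute effective constant C > 0 with the following property. Let g ≥ 2, let k be an even positive integer, and let F be a non-zero Siegel cusp form of weight k on Γ_g = Sp_g(ℤ) whose Fourier coefficients a(T) (T a positive definite half-integral symmetric g×g matrix) are all real. Then there exist positive definite half-integral symmetric g×g matrices T₁ and T₂ with tr T₁ ≤ C·(k·c_g)^5·(log(k·c_g))^26 and tr T₂ ≤ C·(k·c_g)^5·(log(k·c_g))^26 such that a(T₁) > 0 and a(T₂) < 0, where c_g := g·2^{g−1}·(4/3)^{g(g−1)/2}. -/

import Mathlib

open scoped BigOperators
open Complex Matrix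

noncomputable section

attribute [local instance] Matrix.normedAddCommGroup Matrix.normedSpace

/-- A positive definite half-integral symmetric real matrix: symmetric, positive definite,
integral diagonal entries, and off-diagonal entries in `½ℤ`. -/
def IsPDHalfIntegral {g : ℕ} (T : Matrix (Fin g) (Fin g) ℝ) : Prop :=
  T.IsSymm ∧ T.PosDef ∧ (∀ i, ∃ n : ℤ, T i i = (n : ℝ)) ∧
    (∀ i j, i ≠ j → ∃ n : ℤ, T i j = (n : ℝ) / 2)

/-- The Siegel upper half-space of genus `g`: symmetric complex matrices with positive
definite imaginary part. -/
def SiegelUpperHalf (g : ℕ) : Set (Matrix (Fin g) (Fin g) ℂ) :=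
  {Z | Z.IsSymm ∧ (Z.map Complex.im).PosDef}

/-- A Siegel cusp form of weight `k` on `Sp_g(ℤ)`, bundled with its Fourier
coefficients `coeff`. -/
structure SiegelCuspForm (g k : ℕ) where
  toFun : Matrix (Fin g) (Fin g) ℂ → ℂ
  coeff : Matrix (Fin g) (Fin g) ℝ → ℂ
  holo : DifferentiableOn ℂ toFun (SiegelUpperHalf g)
  transform : ∀ A B C D : Matrix (Fin g) (Fin g) ℤ,
    Matrix.fromBlocks A B C D ∈ Matrix.symplecticGroup (Fin g) ℤ →
    ∀ Z ∈ SiegelUpperHalf g,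
      toFun ((A.map (Int.cast : ℤ → ℂ) * Z + B.map (Int.cast : ℤ → ℂ)) *
             (C.map (Int.cast : ℤ → ℂ) * Z + D.map (Int.cast : ℤ → ℂ))⁻¹) =
        (C.map (Int.cast : ℤ → ℂ) * Z + D.map (Int.cast : ℤ → ℂ)).det ^ k * toFun Z
  fourier : ∀ Z ∈ SiegelUpperHalf g,
    toFun Z = ∑' T : {T : Matrix (Fin g) (Fin g) ℝ // IsPDHalfIntegral T},
      coeff T.1 * Complex.exp (2 * Real.pi * Complex.I *
        ((T.1.map (Complex.ofReal)) * Z).trace)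

/-- The constant `c_g = g · 2^(g-1) · (4/3)^(g(g-1)/2)`. -/
def siegelConst (g : ℕ) : ℝ := g * 2 ^ (g - 1) * (4 / 3 : ℝ) ^ (g * (g - 1) / 2)

section PosDefFacts

variable {ι : Type*} [Fintype ι]

lemma Matrix.PosSemidef.conj_transpose {κ : Type*} [Fintype κ]
    {A : Matrix ι ι ℝ} (hA : A.PosSemidef) (B : Matrix κ ι ℝ) : (B * A * Bᵀ).PosSemidef := by
  simpa [conjTranspose_eq_transpose_of_trivial] using hA.mul_mul_conjTranspose_same B

variable [DecidableEq ι]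

open scoped MatrixOrder in
/-- A positive semidefinite real matrix has a symmetric square root. -/
lemma Matrix.PosSemidef.exists_symm_sqrt {A : Matrix ι ι ℝ} (hA : A.PosSemidef) :
    ∃ S : Matrix ι ι ℝ, Sᵀ = S ∧ S * S = A := by
  refine ⟨CFC.sqrt A, ?_, CFC.sqrt_mul_sqrt_self A hA.nonneg⟩
  have h := (CFC.sqrt_nonneg A).posSemidef.isHermitian
  simpa [IsHermitian, conjTranspose_eq_transpose_of_trivial] using h

lemma Matrix.PosSemidef.trace_mul_nonneg {A B : Matrix ι ι ℝ} (hA : A.PosSemidef)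
    (hB : B.PosSemidef) : 0 ≤ (A * B).trace := by
  obtain ⟨S, hS, rfl⟩ := hA.exists_symm_sqrt
  have h := (hB.conj_transpose S).trace_nonneg
  rwa [hS, Matrix.trace_mul_comm, ← Matrix.mul_assoc] at h

/-- Spectral decomposition in the form used below. -/
lemma Matrix.PosSemidef.exists_diagonalization {A : Matrix ι ι ℝ} (hA : A.PosSemidef) :
    ∃ (Q : Matrix ι ι ℝ) (d : ι → ℝ), Qᵀ * Q = 1 ∧ Q * Qᵀ = 1 ∧ (∀ i, 0 ≤ d i) ∧
      A = Q * diagonal d * Qᵀ := by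
  have h := hA.isHermitian.spectral_theorem
  refine ⟨hA.isHermitian.eigenvectorUnitary, hA.isHermitian.eigenvalues, ?_, ?_,
    hA.eigenvalues_nonneg, ?_⟩
  · have := (Unitary.mem_iff.mp hA.isHermitian.eigenvectorUnitary.2).1
    simpa [star_eq_conjTranspose, conjTranspose_eq_transpose_of_trivial] using this
  · have := (Unitary.mem_iff.mp hA.isHermitian.eigenvectorUnitary.2).2
    simpa [star_eq_conjTranspose, conjTranspose_eq_transpose_of_trivial] using this
  · conv_lhs => rw [h, Unitary.conjStarAlgAut_apply]
    rw [star_eq_conjTranspose, conjTranspose_eq_transpose_of_trivial]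
    rfl

lemma Matrix.PosSemidef.one_le_det_one_add {A : Matrix ι ι ℝ} (hA : A.PosSemidef) :
    1 ≤ (1 + A).det := by
  obtain ⟨Q, d, -, h2, hd, rfl⟩ := hA.exists_diagonalization
  have h : 1 + Q * diagonal d * Qᵀ = Q * diagonal (fun i => 1 + d i) * Qᵀ := by
    have : diagonal (fun i => 1 + d i) = 1 + diagonal d := by
      rw [← diagonal_one, diagonal_add]
    rw [this, Matrix.mul_add, Matrix.add_mul, Matrix.mul_one, h2]
  have hdet : Q.det * Q.det = 1 := by
    have := congrArg Matrix.det h2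
    rwa [det_mul, det_transpose, det_one] at this
  rw [h, det_mul, det_mul, det_transpose, det_diagonal, mul_right_comm, hdet, one_mul]
  calc (1 : ℝ) = ∏ _i : ι, (1 : ℝ) := by simp
    _ ≤ ∏ i, (1 + d i) := Finset.prod_le_prod (fun _ _ => zero_le_one) fun i _ => by
        linarith [hd i]

lemma Matrix.PosSemidef.det_le_trace_pow {A : Matrix ι ι ℝ} (hA : A.PosSemidef) :
    A.det ≤ A.trace ^ Fintype.card ι := by
  have h1 := hA.isHermitian.det_eq_prod_eigenvalues
  have h2 := hA.isHermitian.trace_eq_sum_eigenvalues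
  simp only [RCLike.ofReal_real_eq_id, id] at h1 h2
  rw [h1, h2, ← Finset.card_univ, ← Finset.prod_const]
  exact Finset.prod_le_prod (fun i _ => hA.eigenvalues_nonneg i) fun i _ =>
    Finset.single_le_sum (f := hA.isHermitian.eigenvalues)
      (fun j _ => hA.eigenvalues_nonneg j) (Finset.mem_univ i)

lemma Matrix.PosSemidef.trace_smul_one_sub {A : Matrix ι ι ℝ} (hA : A.PosSemidef) :
    (A.trace • (1 : Matrix ι ι ℝ) - A).PosSemidef := by
  obtain ⟨Q, d, h1, h2, hd, rfl⟩ := hA.exists_diagonalization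
  have ht : (Q * diagonal d * Qᵀ).trace = ∑ i, d i := by
    rw [Matrix.trace_mul_comm, ← Matrix.mul_assoc, h1, Matrix.one_mul, trace_diagonal]
  have h : (∑ i, d i) • (1 : Matrix ι ι ℝ) - Q * diagonal d * Qᵀ =
      Q * diagonal (fun i => (∑ j, d j) - d i) * Qᵀ := by
    have : diagonal (fun i => (∑ j, d j) - d i) = (∑ j, d j) • 1 - diagonal d := by
      rw [← diagonal_one, ← diagonal_smul, diagonal_sub]
      congr 1; funext i; simp
    rw [this, Matrix.mul_sub, Matrix.sub_mul, Matrix.mul_smul, Matrix.mul_one, Matrix.smul_mul, h2]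
  rw [ht, h]
  refine (PosSemidef.diagonal fun i => ?_).conj_transpose Q
  simpa using Finset.single_le_sum (fun j _ => hd j) (Finset.mem_univ i)

lemma Matrix.PosDef.exists_symm_sqrt {A : Matrix ι ι ℝ} (hA : A.PosDef) :
    ∃ S R : Matrix ι ι ℝ, Sᵀ = S ∧ Rᵀ = R ∧ S * S = A ∧ S * R = 1 ∧ R * S = 1 := by
  obtain ⟨S, hS, hSA⟩ := hA.posSemidef.exists_symm_sqrt
  have hu : IsUnit S.det := by
    have := hA.det_pos
    rw [← hSA, det_mul] at this
    exact isUnit_iff_ne_zero.mpr fun h => by simp [h] at this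
  exact ⟨S, S⁻¹, hS, by rw [transpose_nonsing_inv, hS], hSA, mul_nonsing_inv _ hu,
    nonsing_inv_mul _ hu⟩

/-- The determinant is monotone for the Loewner order. -/
lemma Matrix.PosDef.det_le_det {A B : Matrix ι ι ℝ} (hB : B.PosDef)
    (hAB : (A - B).PosSemidef) : B.det ≤ A.det := by
  obtain ⟨S, R, hS, hR, rfl, hSR, hRS⟩ := hB.exists_symm_sqrt
  have h1 := (hAB.conj_transpose R).one_le_det_one_add
  rw [hR] at h1
  have h2 : A = S * (1 + R * (A - S * S) * R) * S := by
    have e : S * (R * (A - S * S) * R) * S = (S * R) * (A - S * S) * (R * S) := by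
      simp only [Matrix.mul_assoc]
    rw [Matrix.mul_add, Matrix.add_mul, e, hSR, hRS]
    simp
  rw [h2, det_mul, det_mul, det_mul]
  nlinarith [mul_self_nonneg S.det]

lemma Matrix.PosDef.sub_inv_trace_smul_one {Y : Matrix ι ι ℝ} (hY : Y.PosDef) {r : ℝ}
    (hr0 : 0 < r) (hr : Y⁻¹.trace ≤ r) : (Y - r⁻¹ • (1 : Matrix ι ι ℝ)).PosSemidef := by
  obtain ⟨S, R, hS, hR, hSS, hSR, hRS⟩ := hY.exists_symm_sqrt
  have hinv : Y⁻¹ = R * R := by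
    refine Matrix.inv_eq_right_inv ?_
    rw [← hSS, show S * S * (R * R) = S * (S * R) * R by simp only [Matrix.mul_assoc], hSR,
      Matrix.mul_one, hSR]
  have h1 := (hY.inv.posSemidef.trace_smul_one_sub).conj_transpose S
  have h2 : S * (Y⁻¹.trace • (1 : Matrix ι ι ℝ) - Y⁻¹) * Sᵀ = Y⁻¹.trace • Y - 1 := by
    rw [hS, Matrix.mul_sub, Matrix.sub_mul, Matrix.mul_smul, Matrix.mul_one, Matrix.smul_mul, hSS]
    congr 1
    rw [hinv, show S * (R * R) * S = (S * R) * (R * S) by simp only [Matrix.mul_assoc], hSR, hRS,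
      Matrix.one_mul]
  rw [h2] at h1
  have h3 : Y - r⁻¹ • (1 : Matrix ι ι ℝ) =
      r⁻¹ • ((Y⁻¹.trace • Y - 1) + (r - Y⁻¹.trace) • Y) := by
    rw [sub_smul, show Y⁻¹.trace • Y - 1 + (r • Y - Y⁻¹.trace • Y) = r • Y - 1 by abel,
      smul_sub, smul_smul, inv_mul_cancel₀ hr0.ne', one_smul]
  rw [h3]
  exact (h1.add (hY.posSemidef.smul (sub_nonneg.mpr hr))).smul (inv_nonneg.mpr hr0.le)

end PosDefFacts

section LatticeReduction

/-- The value of the quadratic form with matrix `W` at `x`. -/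
def quadVal {n : ℕ} (W : Matrix (Fin n) (Fin n) ℝ) (x : Fin n → ℝ) : ℝ :=
  ∑ i, ∑ j, W i j * x i * x j

/-- The Schur complement of the upper left entry. -/
def schurTail {n : ℕ} (W : Matrix (Fin (n + 1)) (Fin (n + 1)) ℝ) : Matrix (Fin n) (Fin n) ℝ :=
  Matrix.of fun i j => W i.succ j.succ - W 0 i.succ * W 0 j.succ / W 0 0

lemma schurTail_symm {n : ℕ} {W : Matrix (Fin (n + 1)) (Fin (n + 1)) ℝ} (hW : Wᵀ = W) :
    (schurTail W)ᵀ = schurTail W := by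
  ext i j
  have h : W j.succ i.succ = W i.succ j.succ := congrFun (congrFun hW i.succ) j.succ
  simp [schurTail, h, mul_comm]

lemma quadVal_completeSquare {n : ℕ} {W : Matrix (Fin (n + 1)) (Fin (n + 1)) ℝ} (hW : Wᵀ = W)
    (ha : W 0 0 ≠ 0) (x : Fin (n + 1) → ℝ) :
    quadVal W x = W 0 0 * (x 0 + (∑ j : Fin n, W 0 j.succ * x j.succ) / W 0 0) ^ 2 +
      quadVal (schurTail W) (fun j => x j.succ) := by
  have hs : ∀ j : Fin n, W j.succ 0 = W 0 j.succ := fun j => congrFun (congrFun hW 0) j.succ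
  have h1 : ∑ i : Fin n, ∑ j : Fin n, W 0 i.succ * W 0 j.succ / W 0 0 * x i.succ * x j.succ =
      (∑ j : Fin n, W 0 j.succ * x j.succ) ^ 2 / W 0 0 := by
    rw [sq, Finset.sum_mul_sum, Finset.sum_div]
    refine Finset.sum_congr rfl fun i _ => ?_
    rw [Finset.sum_div]
    exact Finset.sum_congr rfl fun j _ => by ring
  have h2 : ∑ j : Fin n, W 0 j.succ * x 0 * x j.succ =
      x 0 * ∑ j : Fin n, W 0 j.succ * x j.succ := by
    rw [Finset.mul_sum]; exact Finset.sum_congr rfl fun j _ => by ring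
  have h3 : ∑ j : Fin n, W 0 j.succ * x j.succ * x 0 =
      x 0 * ∑ j : Fin n, W 0 j.succ * x j.succ := by
    rw [Finset.mul_sum]; exact Finset.sum_congr rfl fun j _ => by ring
  simp only [quadVal, schurTail, Matrix.of_apply, Fin.sum_univ_succ, hs, sub_mul,
    Finset.sum_sub_distrib, Finset.sum_add_distrib]
  rw [h1, h2, h3]
  field_simp
  ring

/-- Change of variables for quadratic forms by an integral matrix acting on rows. -/
def intConj {n : ℕ} (U : Matrix (Fin n) (Fin n) ℤ) (W : Matrix (Fin n) (Fin n) ℝ) :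
    Matrix (Fin n) (Fin n) ℝ :=
  U.map (Int.cast : ℤ → ℝ) * W * (U.map (Int.cast : ℤ → ℝ))ᵀ

lemma quadVal_eq_dotProduct {n : ℕ} (W : Matrix (Fin n) (Fin n) ℝ) (x : Fin n → ℝ) :
    quadVal W x = x ⬝ᵥ W *ᵥ x := by
  simp only [quadVal, dotProduct, mulVec, Finset.mul_sum]
  exact Finset.sum_congr rfl fun i _ => Finset.sum_congr rfl fun j _ => by ring

lemma quadVal_intConj {n : ℕ} (U : Matrix (Fin n) (Fin n) ℤ) (W : Matrix (Fin n) (Fin n) ℝ)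
    (x : Fin n → ℝ) :
    quadVal (intConj U W) x = quadVal W ((U.map (Int.cast : ℤ → ℝ))ᵀ *ᵥ x) := by
  rw [quadVal_eq_dotProduct, quadVal_eq_dotProduct, intConj, ← mulVec_mulVec, ← mulVec_mulVec,
    dotProduct_mulVec, ← mulVec_transpose]

lemma map_intCast_mul {n : ℕ} (U V : Matrix (Fin n) (Fin n) ℤ) :
    (U * V).map (Int.cast : ℤ → ℝ) = U.map (Int.cast : ℤ → ℝ) * V.map (Int.cast : ℤ → ℝ) :=
  Matrix.map_mul (f := Int.castRingHom ℝ)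

lemma map_intCast_one {n : ℕ} :
    (1 : Matrix (Fin n) (Fin n) ℤ).map (Int.cast : ℤ → ℝ) = 1 :=
  Matrix.map_one _ Int.cast_zero Int.cast_one

lemma quadVal_row_mul {n : ℕ} (U U' : Matrix (Fin n) (Fin n) ℤ) (W : Matrix (Fin n) (Fin n) ℝ)
    (i : Fin n) :
    quadVal W (fun j => ((U' * U) i j : ℝ)) = quadVal (intConj U W) (fun j => (U' i j : ℝ)) := by
  rw [quadVal_intConj]
  congr 1
  funext j
  simp [mulVec, dotProduct, Matrix.mul_apply, mul_comm]

/-- Extension of a unimodular matrix by one row and column, with a free first column. -/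
def unimodExtend {n : ℕ} (c : Fin n → ℤ) (U : Matrix (Fin n) (Fin n) ℤ) :
    Matrix (Fin (n + 1)) (Fin (n + 1)) ℤ :=
  Matrix.of (Fin.cons (Fin.cons 1 0) fun i => Fin.cons (c i) (U i))

lemma unimodExtend_mul {n : ℕ} {U V : Matrix (Fin n) (Fin n) ℤ} (hUV : U * V = 1)
    (c : Fin n → ℤ) : unimodExtend c U * unimodExtend (-(V *ᵥ c)) V = 1 := by
  have hVU : V * U = 1 := mul_eq_one_comm.mp hUV
  ext i j
  refine Fin.cases ?_ (fun i => ?_) i <;> refine Fin.cases ?_ (fun j => ?_) j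
  · simp [unimodExtend, Matrix.mul_apply, Fin.sum_univ_succ]
  · simp [unimodExtend, Matrix.mul_apply, Fin.sum_univ_succ, (Fin.succ_ne_zero _).symm]
  · have h : (U *ᵥ (V *ᵥ c)) i = c i := by rw [mulVec_mulVec, hUV, one_mulVec]
    have h' : ∑ x, U i x * (V *ᵥ c) x = c i := h
    simp [unimodExtend, Matrix.mul_apply, Fin.sum_univ_succ, Fin.succ_ne_zero, h']
  · have h : (U * V) i j = (1 : Matrix (Fin n) (Fin n) ℤ) i j := by rw [hUV]
    simpa [unimodExtend, Matrix.mul_apply, Fin.sum_univ_succ, Matrix.one_apply] using h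

lemma swap_unimod {n : ℕ} (i j : Fin n) :
    (Equiv.swap i j).toPEquiv.toMatrix * (Equiv.swap i j).toPEquiv.toMatrix =
      (1 : Matrix (Fin n) (Fin n) ℤ) := by
  rw [← PEquiv.toMatrix_trans, ← Equiv.toPEquiv_trans, Equiv.swap_swap, Equiv.toPEquiv_refl,
    PEquiv.toMatrix_refl]

/-- The hypothesis on `W`: every vector of every integral dual basis is attained with small
norm. -/
def DualBounded {n : ℕ} (W : Matrix (Fin n) (Fin n) ℝ) (b : ℝ) : Prop :=
  ∀ U V : Matrix (Fin n) (Fin n) ℤ, U * V = 1 → ∀ i, ∃ x : Fin n → ℝ,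
    ∑ j, (V j i : ℝ) * x j = 1 ∧ quadVal W x ≤ b

lemma DualBounded.intConj {n : ℕ} {W : Matrix (Fin n) (Fin n) ℝ} {b : ℝ} (h : DualBounded W b)
    {U V : Matrix (Fin n) (Fin n) ℤ} (hUV : U * V = 1) : DualBounded (intConj U W) b := by
  intro U' V' hUV' i
  have h1 : (U' * U) * (V * V') = 1 := by
    rw [Matrix.mul_assoc, ← Matrix.mul_assoc U, hUV, Matrix.one_mul, hUV']
  obtain ⟨x, hx1, hx2⟩ := h _ _ h1 i
  refine ⟨(V.map (Int.cast : ℤ → ℝ))ᵀ *ᵥ x, ?_, ?_⟩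
  · rw [← hx1]
    simp only [mulVec, dotProduct, Matrix.mul_apply, Finset.mul_sum, Int.cast_sum, Int.cast_mul,
      Finset.sum_mul, transpose_apply, map_apply]
    rw [Finset.sum_comm]
    exact Finset.sum_congr rfl fun j _ => Finset.sum_congr rfl fun k _ => by ring
  · rw [quadVal_intConj, mulVec_mulVec, ← transpose_mul, ← map_intCast_mul,
      mul_eq_one_comm.mp hUV, map_intCast_one, transpose_one, one_mulVec]
    exact hx2

lemma DualBounded.schurTail {n : ℕ} {W : Matrix (Fin (n + 1)) (Fin (n + 1)) ℝ} {b : ℝ}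
    (hW : Wᵀ = W) (ha : 0 < W 0 0) (h : DualBounded W b) : DualBounded (schurTail W) b := by
  intro U V hUV i
  have h1 := unimodExtend_mul hUV 0
  obtain ⟨x, hx1, hx2⟩ := h _ _ h1 i.succ
  refine ⟨fun j => x j.succ, ?_, ?_⟩
  · simpa [unimodExtend, Fin.sum_univ_succ] using hx1
  · rw [quadVal_completeSquare hW ha.ne'] at hx2
    nlinarith [mul_nonneg ha.le (sq_nonneg
      (x 0 + (∑ j : Fin n, W 0 j.succ * x j.succ) / W 0 0))]

/-- A positive definite form whose dual lattice has no short primitive vectors has an integral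
basis consisting of short vectors. -/
lemma exists_short_basis {n : ℕ} : ∀ (W : Matrix (Fin n) (Fin n) ℝ) (b : ℝ), 0 < b → Wᵀ = W →
    (∀ x, x ≠ 0 → 0 < quadVal W x) → DualBounded W b →
    ∃ U V : Matrix (Fin n) (Fin n) ℤ, U * V = 1 ∧
      ∀ i, quadVal W (fun j => (U i j : ℝ)) ≤ 2 ^ n * b := by
  induction n with
  | zero => exact fun W b _ _ _ _ => ⟨1, 1, by simp, fun i => i.elim0⟩
  | succ n ih =>
    intro W b hb hW hpos hdual
    let s : Set ℝ := {t | ∃ U V : Matrix (Fin (n + 1)) (Fin (n + 1)) ℤ, U * V = 1 ∧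
      t = intConj U W 0 0}
    have hposU : ∀ U V : Matrix (Fin (n + 1)) (Fin (n + 1)) ℤ, U * V = 1 →
        ∀ x, x ≠ 0 → 0 < quadVal (intConj U W) x := by
      intro U V hUV x hx
      rw [quadVal_intConj]
      refine hpos _ fun h0 => hx ?_
      have : (V.map (Int.cast : ℤ → ℝ))ᵀ *ᵥ ((U.map (Int.cast : ℤ → ℝ))ᵀ *ᵥ x) = x := by
        rw [mulVec_mulVec, ← transpose_mul, ← map_intCast_mul, hUV, map_intCast_one,
          transpose_one, one_mulVec]
      rw [← this, h0, mulVec_zero]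
    have hdiag : ∀ (M : Matrix (Fin (n + 1)) (Fin (n + 1)) ℝ) i,
        M i i = quadVal M (Pi.single i 1) := by
      intro M i
      simp [quadVal_eq_dotProduct]
    have hdiagpos : ∀ U V : Matrix (Fin (n + 1)) (Fin (n + 1)) ℤ, U * V = 1 →
        0 < intConj U W 0 0 := by
      intro U V hUV
      rw [hdiag (intConj U W)]
      exact hposU U V hUV _ (by simp)
    have hbdd : BddBelow s := ⟨0, by
      rintro t ⟨U, V, hUV, rfl⟩
      exact (hdiagpos U V hUV).le⟩
    have hne : s.Nonempty := ⟨_, 1, 1, by simp, rfl⟩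
    have hη : 0 < 2 ^ n * b / 2 := by positivity
    obtain ⟨t, ⟨U₀, V₀, hUV₀, rfl⟩, ht⟩ := exists_lt_of_csInf_lt hne
      (lt_add_of_pos_right (sInf s) hη)
    set W₀ := intConj U₀ W with hW₀
    set a := W₀ 0 0 with ha_def
    have ha : 0 < a := hdiagpos U₀ V₀ hUV₀
    have hsymm : W₀ᵀ = W₀ := by
      simp [hW₀, intConj, hW, Matrix.mul_assoc]
    have hmin : ∀ U V : Matrix (Fin (n + 1)) (Fin (n + 1)) ℤ, U * V = 1 →
        a ≤ quadVal W₀ (fun j => (U 0 j : ℝ)) + 2 ^ n * b / 2 := by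
      intro U V hUV
      have hmem : intConj (U * U₀) W 0 0 ∈ s := ⟨U * U₀, V₀ * V, by
        rw [Matrix.mul_assoc, ← Matrix.mul_assoc U₀, hUV₀, Matrix.one_mul, hUV], rfl⟩
      have h1 := csInf_le hbdd hmem
      have h2 : intConj (U * U₀) W 0 0 = quadVal W₀ (fun j => (U 0 j : ℝ)) := by
        rw [hdiag (intConj (U * U₀) W), quadVal_intConj, ← quadVal_row_mul]
        congr 1
        funext j
        simp
      linarith
    have hpos₀ := hposU U₀ V₀ hUV₀
    have hS := schurTail_symm hsymm
    have hSpos : ∀ x, x ≠ 0 → 0 < quadVal (schurTail W₀) x := by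
      intro x hx
      have h1 := hpos₀ (Fin.cons (-((∑ j : Fin n, W₀ 0 j.succ * x j) / a)) x) (by
        intro h0
        apply hx
        funext j
        have := congrFun h0 j.succ
        simpa using this)
      rw [quadVal_completeSquare hsymm ha.ne'] at h1
      simpa [← ha_def] using h1
    have hdual₀ : DualBounded W₀ b := hdual.intConj hUV₀
    obtain ⟨U', V', hUV', hU'⟩ := ih _ b hb hS hSpos (hdual₀.schurTail hsymm ha)
    let ρ : Fin n → ℝ := fun i => (∑ j : Fin n, W₀ 0 j.succ * (U' i j : ℝ)) / a
    let c : Fin n → ℤ := fun i => -round (ρ i)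
    have hUV₁ := unimodExtend_mul hUV' c
    set U₁ := unimodExtend c U' with hU₁
    set V₁ := unimodExtend (-(V' *ᵥ c)) V'
    have hrow : ∀ i : Fin n, quadVal W₀ (fun j => (U₁ i.succ j : ℝ)) ≤ a / 4 + 2 ^ n * b := by
      intro i
      rw [quadVal_completeSquare hsymm ha.ne']
      have h1 := hU' i
      have h2 : |ρ i - round (ρ i)| ≤ 1 / 2 := abs_sub_round (ρ i)
      have h3 : (ρ i - round (ρ i)) ^ 2 ≤ 1 / 4 := by
        rw [← sq_abs]; nlinarith [abs_nonneg (ρ i - round (ρ i))]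
      have e1 : ((U₁ i.succ 0 : ℤ) : ℝ) + (∑ j : Fin n, W₀ 0 j.succ * (U₁ i.succ j.succ : ℝ)) /
          W₀ 0 0 = ρ i - round (ρ i) := by
        simp only [hU₁, unimodExtend, Matrix.of_apply, Fin.cons_succ, Fin.cons_zero, c, ρ,
          ← ha_def]
        push_cast
        ring
      have e2 : (fun j : Fin n => (U₁ i.succ j.succ : ℝ)) = fun j => (U' i j : ℝ) := by
        funext j; simp [hU₁, unimodExtend]
      rw [e1, e2, ← ha_def]
      nlinarith
    have ha_le : a ≤ 2 ^ (n + 1) * b := by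
      rcases n.eq_zero_or_pos with rfl | hn
      · obtain ⟨x, hx1, hx2⟩ := hdual₀ 1 1 (by simp) 0
        have hx : x 0 = 1 := by simpa using hx1
        have : quadVal W₀ x = a := by simp [quadVal, hx, ha_def]
        rw [this] at hx2
        norm_num
        linarith
      · let i : Fin n := ⟨0, hn⟩
        let P : Matrix (Fin (n + 1)) (Fin (n + 1)) ℤ :=
          (Equiv.swap (0 : Fin (n + 1)) i.succ).toPEquiv.toMatrix
        have hP : (P * U₁) * (V₁ * P) = 1 := by
          rw [Matrix.mul_assoc, ← Matrix.mul_assoc U₁, hUV₁, Matrix.one_mul, swap_unimod]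
        have h1 := hmin _ _ hP
        have h2 : (fun j => (((P * U₁) 0 j : ℤ) : ℝ)) = fun j => (U₁ i.succ j : ℝ) := by
          funext j
          simp [P, PEquiv.toMatrix_toPEquiv_mul]
        rw [h2] at h1
        have := hrow i
        rw [pow_succ]
        linarith
    refine ⟨U₁ * U₀, V₀ * V₁, ?_, ?_⟩
    · rw [Matrix.mul_assoc, ← Matrix.mul_assoc U₀, hUV₀, Matrix.one_mul, hUV₁]
    · intro i
      rw [quadVal_row_mul]
      refine Fin.cases ?_ (fun i => ?_) i
      · have : (fun j => (U₁ 0 j : ℝ)) = Pi.single (0 : Fin (n + 1)) (1 : ℝ) := by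
          funext j
          refine Fin.cases ?_ (fun j => ?_) j <;>
            simp [hU₁, unimodExtend]
        rw [this, ← hdiag]
        exact ha_le
      · refine (hrow i).trans ?_
        rw [pow_succ] at ha_le ⊢
        have : 0 < 2 ^ n * b := by positivity
        linarith

end LatticeReduction

section SymplecticAction

open scoped ComplexOrder

variable {g : ℕ}

/-- The complex matrix with the entries of an integral matrix. -/
abbrev intC (A : Matrix (Fin g) (Fin g) ℤ) : Matrix (Fin g) (Fin g) ℂ :=
  A.map (Int.cast : ℤ → ℂ)

/-- The complex matrix with the entries of a real matrix. -/
abbrev realC (A : Matrix (Fin g) (Fin g) ℝ) : Matrix (Fin g) (Fin g) ℂ :=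
  A.map Complex.ofReal

/-- The imaginary part of a complex matrix. -/
abbrev imR (Z : Matrix (Fin g) (Fin g) ℂ) : Matrix (Fin g) (Fin g) ℝ :=
  Z.map Complex.im

lemma intC_mul (A B : Matrix (Fin g) (Fin g) ℤ) : intC (A * B) = intC A * intC B :=
  Matrix.map_mul (f := Int.castRingHom ℂ)

lemma intC_one : intC (1 : Matrix (Fin g) (Fin g) ℤ) = 1 := by
  simp [intC]

lemma intC_add (A B : Matrix (Fin g) (Fin g) ℤ) : intC (A + B) = intC A + intC B := by
  ext; simp

lemma intC_sub (A B : Matrix (Fin g) (Fin g) ℤ) : intC (A - B) = intC A - intC B := by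
  ext; simp

lemma intC_conjTranspose (A : Matrix (Fin g) (Fin g) ℤ) : (intC A)ᴴ = (intC A)ᵀ := by
  ext; simp

lemma intC_transpose (A : Matrix (Fin g) (Fin g) ℤ) : (intC A)ᵀ = intC Aᵀ := rfl

lemma realC_mul (A B : Matrix (Fin g) (Fin g) ℝ) : realC (A * B) = realC A * realC B :=
  Matrix.map_mul (f := Complex.ofRealHom)

lemma realC_one : realC (1 : Matrix (Fin g) (Fin g) ℝ) = 1 := by
  simp [realC]

lemma realC_injective : Function.Injective (realC (g := g)) :=
  Matrix.map_injective Complex.ofReal_injective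

lemma realC_det (A : Matrix (Fin g) (Fin g) ℝ) : (realC A).det = ((A.det : ℝ) : ℂ) :=
  (RingHom.map_det Complex.ofRealHom A).symm

lemma realC_posDef_iff (Y : Matrix (Fin g) (Fin g) ℝ) : (realC Y).PosDef ↔ Y.PosDef := by
  constructor
  · intro h
    refine Matrix.PosDef.of_dotProduct_mulVec_pos ?_ ?_
    · have := h.isHermitian
      ext i j
      have h2 := congrFun (congrFun this i) j
      simpa [conjTranspose_apply] using h2
    · intro x hx
      have hx' : (fun i => (x i : ℂ)) ≠ 0 := by
        intro h0
        exact hx (funext fun i => by simpa using congrFun h0 i)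
      have h2 := h.dotProduct_mulVec_pos hx'
      have h3 : (star (fun i => (x i : ℂ))) ⬝ᵥ (realC Y *ᵥ fun i => (x i : ℂ)) =
          ((star x ⬝ᵥ Y *ᵥ x : ℝ) : ℂ) := by
        simp [dotProduct, mulVec]
      rw [h3] at h2
      exact_mod_cast h2
  · intro h
    obtain ⟨S, R, hS, -, hSS, -, hRS⟩ := h.exists_symm_sqrt
    have h1 : realC Y = (realC S)ᴴ * realC S := by
      have : (realC S)ᴴ = realC S := by
        ext i j
        have := congrFun (congrFun hS i) j
        simp only [transpose_apply] at this
        simp [conjTranspose_apply, this]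
      rw [this, ← realC_mul, hSS]
    rw [h1]
    apply Matrix.PosDef.conjTranspose_mul_self
    apply Function.LeftInverse.injective (g := fun v => realC R *ᵥ v)
    intro v
    simp only [mulVec_mulVec]
    rw [← realC_mul, hRS, realC_one, one_mulVec]

lemma sub_conjTranspose_of_symm {Z : Matrix (Fin g) (Fin g) ℂ} (hZ : Zᵀ = Z) :
    Z - Zᴴ = (2 * Complex.I) • realC (imR Z) := by
  ext i j
  have h : Z j i = Z i j := congrFun (congrFun hZ i) j
  simp only [Matrix.sub_apply, conjTranspose_apply, h, Matrix.smul_apply, map_apply, smul_eq_mul]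
  apply Complex.ext <;> simp
  ring

structure SpBlocks (a b c d : Matrix (Fin g) (Fin g) ℂ) : Prop where
  ac : aᵀ * c = cᵀ * a
  bd : bᵀ * d = dᵀ * b
  ad : aᵀ * d - cᵀ * b = 1
  da : dᵀ * a - bᵀ * c = 1
  ha : aᴴ = aᵀ
  hb : bᴴ = bᵀ
  hc : cᴴ = cᵀ
  hd : dᴴ = dᵀ

lemma spBlocks_of_mem {A B C D : Matrix (Fin g) (Fin g) ℤ}
    (h : fromBlocks A B C D ∈ symplecticGroup (Fin g) ℤ) :
    SpBlocks (intC A) (intC B) (intC C) (intC D) := by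
  obtain ⟨h1, h2, h3⟩ := SymplecticGroup.fromBlocks_mem_iff.mp h
  have h4 : Dᵀ * A - Bᵀ * C = 1 := by
    have := congrArg transpose h3
    simpa using this
  refine ⟨?_, ?_, ?_, ?_, intC_conjTranspose _, intC_conjTranspose _, intC_conjTranspose _,
    intC_conjTranspose _⟩
  · simpa only [intC_mul, ← intC_transpose] using congrArg intC h1
  · simpa only [intC_mul, ← intC_transpose] using congrArg intC h2
  · simpa only [intC_mul, ← intC_transpose, intC_sub, intC_one] using congrArg intC h3
  · simpa only [intC_mul, ← intC_transpose, intC_sub, intC_one] using congrArg intC h4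

variable {a b c d Z Z' : Matrix (Fin g) (Fin g) ℂ}

lemma SpBlocks.transpose_mul_comm (h : SpBlocks a b c d) (hZ : Zᵀ = Z) :
    (a * Z + b)ᵀ * (c * Z + d) = (c * Z + d)ᵀ * (a * Z + b) := by
  simp only [transpose_add, transpose_mul, hZ]
  rw [← sub_eq_zero]
  have : (Z * aᵀ + bᵀ) * (c * Z + d) - (Z * cᵀ + dᵀ) * (a * Z + b) =
      Z * (aᵀ * c - cᵀ * a) * Z + Z * (aᵀ * d - cᵀ * b) - (dᵀ * a - bᵀ * c) * Z +
      (bᵀ * d - dᵀ * b) := by noncomm_ring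
  rw [this, h.ac, h.bd, h.ad, h.da]
  simp

lemma SpBlocks.conjTranspose_mul_sub (h : SpBlocks a b c d) :
    (c * Z + d)ᴴ * (a * Z + b) - (a * Z + b)ᴴ * (c * Z + d) = Z - Zᴴ := by
  simp only [conjTranspose_add, conjTranspose_mul, h.ha, h.hb, h.hc, h.hd]
  have : (Zᴴ * cᵀ + dᵀ) * (a * Z + b) - (Zᴴ * aᵀ + bᵀ) * (c * Z + d) =
      - (Zᴴ * (aᵀ * c - cᵀ * a) * Z) - Zᴴ * (aᵀ * d - cᵀ * b) + (dᵀ * a - bᵀ * c) * Z -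
      (bᵀ * d - dᵀ * b) := by noncomm_ring
  rw [this, h.ac, h.bd, h.ad, h.da]
  simp
  abel

lemma SpBlocks.det_ne_zero (h : SpBlocks a b c d) (hZ : Z ∈ SiegelUpperHalf g) :
    (c * Z + d).det ≠ 0 := by
  intro h0
  obtain ⟨v, hv, hJ⟩ := Matrix.exists_mulVec_eq_zero_iff.mpr h0
  have h1 : star v ⬝ᵥ ((Z - Zᴴ) *ᵥ v) = 0 := by
    rw [← h.conjTranspose_mul_sub, sub_mulVec, ← mulVec_mulVec, ← mulVec_mulVec, hJ,
      dotProduct_sub, dotProduct_mulVec, vecMul_conjTranspose, star_star, hJ]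
    simp
  rw [sub_conjTranspose_of_symm hZ.1, smul_mulVec, dotProduct_smul, smul_eq_mul] at h1
  have h2 := ((realC_posDef_iff _).mpr hZ.2).dotProduct_mulVec_pos hv
  have h3 : (2 * Complex.I) ≠ 0 := by simp
  exact h2.ne' ((mul_eq_zero.mp h1).resolve_left h3)

lemma SpBlocks.symm_of_eq (h : SpBlocks a b c d) (hZ : Z ∈ SiegelUpperHalf g)
    (hZ' : a * Z + b = Z' * (c * Z + d)) : Z'ᵀ = Z' := by
  have h1 := h.transpose_mul_comm hZ.1
  rw [hZ', transpose_mul, Matrix.mul_assoc] at h1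
  have hu : IsUnit (c * Z + d) := (isUnit_iff_isUnit_det _).mpr (h.det_ne_zero hZ).isUnit
  have hu' : IsUnit (c * Z + d)ᵀ := (isUnit_transpose _).mpr hu
  exact hu.mul_right_cancel (hu'.mul_left_cancel h1)

lemma SpBlocks.im_eq (h : SpBlocks a b c d) (hZ : Z ∈ SiegelUpperHalf g)
    (hZ' : a * Z + b = Z' * (c * Z + d)) :
    (c * Z + d)ᴴ * realC (imR Z') * (c * Z + d) = realC (imR Z) := by
  have h1 := h.conjTranspose_mul_sub (Z := Z)
  rw [hZ', conjTranspose_mul, Matrix.mul_assoc, ← Matrix.mul_sub, ← Matrix.sub_mul,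
    sub_conjTranspose_of_symm hZ.1, sub_conjTranspose_of_symm (h.symm_of_eq hZ hZ'),
    Matrix.smul_mul, Matrix.mul_smul, ← Matrix.mul_assoc] at h1
  exact smul_right_injective _ (show (2 * Complex.I) ≠ 0 by simp) h1

lemma SpBlocks.mem_upperHalf (h : SpBlocks a b c d) (hZ : Z ∈ SiegelUpperHalf g)
    (hZ' : a * Z + b = Z' * (c * Z + d)) : Z' ∈ SiegelUpperHalf g := by
  refine ⟨h.symm_of_eq hZ hZ', ?_⟩
  have hu : IsUnit (c * Z + d) := (isUnit_iff_isUnit_det _).mpr (h.det_ne_zero hZ).isUnit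
  have h1 := (realC_posDef_iff _).mpr hZ.2
  rw [show realC (Z.map Complex.im) = realC (imR Z) from rfl,
    ← h.im_eq hZ hZ', ← star_eq_conjTranspose,
    Matrix.IsUnit.posDef_star_left_conjugate_iff hu] at h1
  exact (realC_posDef_iff _).mp h1

lemma SpBlocks.det_im (h : SpBlocks a b c d) (hZ : Z ∈ SiegelUpperHalf g)
    (hZ' : a * Z + b = Z' * (c * Z + d)) :
    (imR Z').det * ‖(c * Z + d).det‖ ^ 2 = (imR Z).det := by
  have h1 := congrArg Matrix.det (h.im_eq hZ hZ')
  rw [det_mul, det_mul, det_conjTranspose, realC_det, realC_det, mul_comm, ← mul_assoc] at h1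
  have h2 : (c * Z + d).det * star (c * Z + d).det = ((‖(c * Z + d).det‖ ^ 2 : ℝ) : ℂ) := by
    rw [Complex.star_def, Complex.mul_conj, Complex.normSq_eq_norm_sq]
  rw [h2, mul_comm] at h1
  exact_mod_cast h1

/-- `Z'` is the image of `Z` under an element of `Sp_g(ℤ)`. -/
def SpRel (Z Z' : Matrix (Fin g) (Fin g) ℂ) : Prop :=
  ∃ A B C D : Matrix (Fin g) (Fin g) ℤ, fromBlocks A B C D ∈ symplecticGroup (Fin g) ℤ ∧
    intC A * Z + intC B = Z' * (intC C * Z + intC D)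

lemma SpRel.mem_upperHalf (h : SpRel Z Z') (hZ : Z ∈ SiegelUpperHalf g) :
    Z' ∈ SiegelUpperHalf g := by
  obtain ⟨A, B, C, D, hM, hE⟩ := h
  exact (spBlocks_of_mem hM).mem_upperHalf hZ hE

lemma SpRel.refl (Z : Matrix (Fin g) (Fin g) ℂ) : SpRel Z Z := by
  refine ⟨1, 0, 0, 1, ?_, ?_⟩
  · rw [fromBlocks_one]; exact one_mem _
  · simp [intC]

lemma SpRel.trans {Z'' : Matrix (Fin g) (Fin g) ℂ} (h : SpRel Z Z') (h' : SpRel Z' Z'') :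
    SpRel Z Z'' := by
  obtain ⟨A, B, C, D, hM, hE⟩ := h
  obtain ⟨A', B', C', D', hM', hE'⟩ := h'
  have hmul := mul_mem hM' hM
  rw [fromBlocks_multiply] at hmul
  refine ⟨_, _, _, _, hmul, ?_⟩
  simp only [intC_add, intC_mul]
  calc (intC A' * intC A + intC B' * intC C) * Z + (intC A' * intC B + intC B' * intC D)
      = intC A' * (intC A * Z + intC B) + intC B' * (intC C * Z + intC D) := by noncomm_ring
    _ = (intC A' * Z' + intC B') * (intC C * Z + intC D) := by rw [hE]; noncomm_ring
    _ = Z'' * (intC C' * (Z' * (intC C * Z + intC D)) + intC D' * (intC C * Z + intC D)) := by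
        rw [hE']; noncomm_ring
    _ = _ := by rw [← hE]; noncomm_ring

/-- The invariant function `det(Im Z)^l |F(Z)|` attached to a form of weight `2l`. -/
def petersson (l : ℕ) (f : Matrix (Fin g) (Fin g) ℂ → ℂ) (Z : Matrix (Fin g) (Fin g) ℂ) : ℝ :=
  (imR Z).det ^ l * ‖f Z‖

lemma SpRel.petersson_eq {l : ℕ} (F : SiegelCuspForm g (2 * l)) (h : SpRel Z Z')
    (hZ : Z ∈ SiegelUpperHalf g) : petersson l F.toFun Z' = petersson l F.toFun Z := by
  obtain ⟨A, B, C, D, hM, hE⟩ := h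
  have hb := spBlocks_of_mem hM
  have h0 := hb.det_ne_zero hZ
  have h1 := hb.det_im hZ hE
  have h2 := F.transform A B C D hM Z hZ
  rw [show A.map (Int.cast : ℤ → ℂ) * Z + B.map (Int.cast : ℤ → ℂ) =
    Z' * (intC C * Z + intC D) from hE, Matrix.mul_nonsing_inv_cancel_right _ _ h0.isUnit] at h2
  rw [petersson, petersson, h2, ← h1, norm_mul, norm_pow, mul_pow, pow_mul]
  ring

end SymplecticAction

section Moves

variable {g : ℕ}

lemma exists_spRel {A B C D : Matrix (Fin g) (Fin g) ℤ}
    (hM : fromBlocks A B C D ∈ symplecticGroup (Fin g) ℤ) {Z : Matrix (Fin g) (Fin g) ℂ}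
    (hZ : Z ∈ SiegelUpperHalf g) :
    ∃ Z', SpRel Z Z' ∧ (imR Z').det * ‖(intC C * Z + intC D).det‖ ^ 2 = (imR Z).det := by
  have hb := spBlocks_of_mem hM
  have hE : intC A * Z + intC B = ((intC A * Z + intC B) * (intC C * Z + intC D)⁻¹) *
      (intC C * Z + intC D) :=
    (Matrix.nonsing_inv_mul_cancel_right _ _ (hb.det_ne_zero hZ).isUnit).symm
  exact ⟨_, ⟨A, B, C, D, hM, hE⟩, hb.det_im hZ hE⟩

lemma spRel_add {S : Matrix (Fin g) (Fin g) ℤ} (hS : Sᵀ = S) (Z : Matrix (Fin g) (Fin g) ℂ) :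
    SpRel Z (Z + intC S) := by
  refine ⟨1, S, 0, 1, ?_, ?_⟩
  · rw [SymplecticGroup.fromBlocks_mem_iff]
    simp [hS]
  · simp [intC]

lemma spRel_conj {U V : Matrix (Fin g) (Fin g) ℤ} (hUV : U * V = 1)
    (Z : Matrix (Fin g) (Fin g) ℂ) : SpRel Z (intC U * Z * (intC U)ᵀ) := by
  have hVU : V * U = 1 := mul_eq_one_comm.mp hUV
  refine ⟨U, 0, 0, Vᵀ, ?_, ?_⟩
  · rw [SymplecticGroup.fromBlocks_mem_iff]
    simp [← transpose_mul, hVU]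
  · have : (intC U)ᵀ * intC Vᵀ = 1 := by
      rw [intC_transpose, ← intC_mul, ← transpose_mul, hVU, transpose_one, intC_one]
    have h0 : intC (0 : Matrix (Fin g) (Fin g) ℤ) = 0 := by simp [intC]
    rw [h0, Matrix.zero_mul, zero_add, add_zero, Matrix.mul_assoc, this, Matrix.mul_one]

lemma imR_conj (U : Matrix (Fin g) (Fin g) ℤ) (Z : Matrix (Fin g) (Fin g) ℂ) :
    imR (intC U * Z * (intC U)ᵀ) = intConj U (imR Z) := by
  ext i j
  simp [intConj, Matrix.mul_apply, Finset.sum_mul]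

lemma imR_add_intC (S : Matrix (Fin g) (Fin g) ℤ) (Z : Matrix (Fin g) (Fin g) ℂ) :
    imR (Z + intC S) = imR Z := by
  ext i j
  simp

lemma exists_spRel_inversion (i : Fin g) {Z : Matrix (Fin g) (Fin g) ℂ}
    (hZ : Z ∈ SiegelUpperHalf g) :
    ∃ Z', SpRel Z Z' ∧ (imR Z').det * ‖Z i i‖ ^ 2 = (imR Z).det := by
  set E : Matrix (Fin g) (Fin g) ℤ := Matrix.single i i 1 with hE
  have hEE : E * E = E := by simp [hE]
  have hET : Eᵀ = E := by simp [hE]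
  have hM : fromBlocks (1 - E) (-E) E (1 - E) ∈ symplecticGroup (Fin g) ℤ := by
    rw [SymplecticGroup.fromBlocks_mem_iff]
    simp only [transpose_sub, transpose_one, hET, transpose_neg, Matrix.sub_mul, Matrix.mul_sub,
      Matrix.one_mul, Matrix.mul_one, Matrix.neg_mul, Matrix.mul_neg, hEE]
    simp
  obtain ⟨Z', h1, h2⟩ := exists_spRel hM hZ
  refine ⟨Z', h1, ?_⟩
  have h3 : intC E * Z + intC (1 - E) = updateRow 1 i (Z i) := by
    ext a b
    by_cases ha : a = i
    · subst ha
      simp [hE, Matrix.mul_apply, Matrix.single_apply, Matrix.one_apply]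
    · simp [hE, Matrix.mul_apply, Matrix.one_apply, ha, Ne.symm ha]
  rw [h3] at h2
  have h4 : (updateRow (1 : Matrix (Fin g) (Fin g) ℂ) i (Z i)).det = Z i i := by
    have h5 : Matrix.cramer (1 : Matrix (Fin g) (Fin g) ℂ) (Z i) i = Z i i := by
      rw [Matrix.cramer_one]; rfl
    rw [Matrix.cramer_apply] at h5
    rw [← det_transpose, ← updateCol_transpose, transpose_one, h5]
  rwa [h4] at h2

end Moves
section OrbitBound

variable {g : ℕ}

lemma realC_add (A B : Matrix (Fin g) (Fin g) ℝ) : realC (A + B) = realC A + realC B := by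
  ext; simp

lemma realC_conjTranspose (A : Matrix (Fin g) (Fin g) ℝ) : (realC A)ᴴ = realC Aᵀ := by
  ext; simp

lemma intC_eq_realC (A : Matrix (Fin g) (Fin g) ℤ) :
    intC A = realC (A.map (Int.cast : ℤ → ℝ)) := by
  ext; simp

lemma eq_re_add_im (Z : Matrix (Fin g) (Fin g) ℂ) :
    Z = realC (Z.map Complex.re) + Complex.I • realC (imR Z) := by
  ext i j
  simp [mul_comm Complex.I, Complex.re_add_im]

/-- `(p + iq) w (p + iq)ᴴ` is real when `q w pᵀ = p w qᵀ`. -/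
lemma realC_conj_expand (p q w : Matrix (Fin g) (Fin g) ℝ) (h : q * w * pᵀ = p * w * qᵀ) :
    (realC p + Complex.I • realC q) * realC w * (realC p + Complex.I • realC q)ᴴ =
      realC (p * w * pᵀ + q * w * qᵀ) := by
  have h' : realC q * realC w * realC pᵀ = realC p * realC w * realC qᵀ := by
    rw [← realC_mul, ← realC_mul, h, realC_mul, realC_mul]
  rw [conjTranspose_add, conjTranspose_smul, realC_conjTranspose, realC_conjTranspose, realC_add,
    realC_mul, realC_mul, realC_mul, realC_mul]
  simp only [Matrix.add_mul, Matrix.mul_add, Matrix.smul_mul, Matrix.mul_smul, h',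
    Complex.star_def, Complex.conj_I, neg_smul, Matrix.mul_neg, smul_add, smul_smul,
    Complex.I_mul_I, one_smul]
  abel

/-- The inverse of the imaginary part of a translate under the symplectic group. -/
lemma imR_mul_eq_one {A B C D : Matrix (Fin g) (Fin g) ℤ}
    (hM : fromBlocks A B C D ∈ symplecticGroup (Fin g) ℤ) {Z Z' : Matrix (Fin g) (Fin g) ℂ}
    (hZ : Z ∈ SiegelUpperHalf g)
    (hE : intC A * Z + intC B = Z' * (intC C * Z + intC D))
    {c d X Y W P : Matrix (Fin g) (Fin g) ℝ} (hc : c = C.map (Int.cast : ℤ → ℝ))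
    (hd : d = D.map (Int.cast : ℤ → ℝ)) (hX : X = Z.map Complex.re) (hY : Y = imR Z)
    (hW : Y * W = 1) (hP : P = c * X + d) :
    imR Z' * (P * W * Pᵀ + c * Y * cᵀ) = 1 := by
  have hb := spBlocks_of_mem hM
  have hXs : Xᵀ = X := by
    ext i j
    have h : Z j i = Z i j := congrFun (congrFun hZ.1 i) j
    simp [hX, h]
  have hYs : Yᵀ = Y := by
    ext i j
    have h : Z j i = Z i j := congrFun (congrFun hZ.1 i) j
    simp [hY, h]
  have hWY : W * Y = 1 := mul_eq_one_comm.mp hW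
  have hcd : c * dᵀ = d * cᵀ := by
    have h1 := SymplecticGroup.transpose_mem hM
    rw [fromBlocks_transpose, SymplecticGroup.fromBlocks_mem_iff] at h1
    have h2 := congrArg (fun M : Matrix (Fin g) (Fin g) ℤ => M.map (Int.cast : ℤ → ℝ)) h1.2.1
    simp only [transpose_transpose, map_intCast_mul] at h2
    rw [hc, hd]
    exact h2
  have hPc : P * cᵀ = c * Pᵀ := by
    rw [hP, transpose_add, transpose_mul, hXs, Matrix.add_mul, Matrix.mul_add, hcd,
      Matrix.mul_assoc]
  have hJ : intC C * Z + intC D = realC P + Complex.I • realC (c * Y) := by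
    conv_lhs => rw [eq_re_add_im Z]
    rw [intC_eq_realC, intC_eq_realC, ← hc, ← hd, ← hX, ← hY, hP, realC_add, realC_mul, realC_mul,
      Matrix.mul_add, Matrix.mul_smul]
    abel
  have hcYW : c * Y * W = c := by rw [Matrix.mul_assoc, hW, Matrix.mul_one]
  have h1 := realC_conj_expand P (c * Y) W (by
    rw [hcYW, transpose_mul, hYs, Matrix.mul_assoc P, ← Matrix.mul_assoc W, hWY, Matrix.one_mul,
      hPc])
  rw [hcYW, transpose_mul, hYs, ← Matrix.mul_assoc c, ← hJ] at h1
  have h2 := hb.im_eq hZ hE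
  rw [← hY] at h2
  have h3 : (intC C * Z + intC D)ᴴ * (realC (imR Z') * (intC C * Z + intC D) * realC W) = 1 := by
    rw [← Matrix.mul_assoc, ← Matrix.mul_assoc, h2, ← realC_mul, hW, realC_one]
  have h4 := mul_eq_one_comm.mp h3
  apply realC_injective
  rw [realC_one, realC_mul, ← h1, ← h4]
  simp only [Matrix.mul_assoc]

lemma one_le_det_of_symplectic {A B C D : Matrix (Fin g) (Fin g) ℤ}
    (hM : fromBlocks A B C D ∈ symplecticGroup (Fin g) ℤ) {c d : Matrix (Fin g) (Fin g) ℝ}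
    (hc : c = C.map (Int.cast : ℤ → ℝ)) (hd : d = D.map (Int.cast : ℤ → ℝ)) :
    (c * cᵀ + d * dᵀ).PosDef ∧ 1 ≤ (c * cᵀ + d * dᵀ).det := by
  have h1 := SymplecticGroup.transpose_mem hM
  rw [fromBlocks_transpose, SymplecticGroup.fromBlocks_mem_iff] at h1
  have h2 := congrArg (fun M : Matrix (Fin g) (Fin g) ℤ => M.map (Int.cast : ℤ → ℝ)) h1.2.2
  simp only [transpose_transpose] at h2
  rw [Matrix.map_sub (Int.cast : ℤ → ℝ) Int.cast_sub, map_intCast_mul, map_intCast_mul,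
    map_intCast_one, transpose_map, transpose_map, ← hc, ← hd] at h2
  have hpos : (c * cᵀ + d * dᵀ).PosDef := by
    refine Matrix.PosDef.of_dotProduct_mulVec_pos ?_ ?_
    · simp [IsHermitian, conjTranspose_eq_transpose_of_trivial]
    · intro x hx
      have h3 : star x ⬝ᵥ (c * cᵀ + d * dᵀ) *ᵥ x =
          (cᵀ *ᵥ x) ⬝ᵥ (cᵀ *ᵥ x) + (dᵀ *ᵥ x) ⬝ᵥ (dᵀ *ᵥ x) := by
        rw [star_trivial, add_mulVec, dotProduct_add, ← mulVec_mulVec, ← mulVec_mulVec,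
          mulVec_transpose, mulVec_transpose, dotProduct_mulVec, dotProduct_mulVec]
      have hc0 : 0 ≤ (cᵀ *ᵥ x) ⬝ᵥ (cᵀ *ᵥ x) :=
        Finset.sum_nonneg fun i _ => mul_self_nonneg _
      have hd0 : 0 ≤ (dᵀ *ᵥ x) ⬝ᵥ (dᵀ *ᵥ x) :=
        Finset.sum_nonneg fun i _ => mul_self_nonneg _
      rw [h3]
      refine lt_of_le_of_ne (add_nonneg hc0 hd0) fun h0 => hx ?_
      have hc1 : cᵀ *ᵥ x = 0 := dotProduct_self_eq_zero.mp (by linarith)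
      have hd1 : dᵀ *ᵥ x = 0 := dotProduct_self_eq_zero.mp (by linarith)
      have h4 := congrArg (fun M => M *ᵥ x) h2
      simpa [sub_mulVec, ← mulVec_mulVec, hc1, hd1] using h4.symm
  refine ⟨hpos, ?_⟩
  have h5 : c * cᵀ + d * dᵀ = (C * Cᵀ + D * Dᵀ).map (Int.cast : ℤ → ℝ) := by
    rw [Matrix.map_add (Int.cast : ℤ → ℝ) Int.cast_add, map_intCast_mul, map_intCast_mul, hc, hd]
    rfl
  have h6 : (c * cᵀ + d * dᵀ).det = (((C * Cᵀ + D * Dᵀ).det : ℤ) : ℝ) := by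
    rw [h5]
    exact (RingHom.map_det (Int.castRingHom ℝ) _).symm
  have h7 := hpos.det_pos
  rw [h6] at h7 ⊢
  exact_mod_cast h7

/-- The determinants of the imaginary parts of the points of an orbit are bounded. -/
lemma exists_det_bound {Z : Matrix (Fin g) (Fin g) ℂ} (hZ : Z ∈ SiegelUpperHalf g) :
    ∃ b : ℝ, ∀ Z', SpRel Z Z' → (imR Z').det ≤ b := by
  set Y := imR Z with hY
  set X := Z.map Complex.re with hX
  have hYp : Y.PosDef := hZ.2
  have hYu : IsUnit Y.det := (isUnit_iff_isUnit_det _).mp hYp.isUnit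
  have hYW : Y * Y⁻¹ = 1 := Matrix.mul_nonsing_inv _ hYu
  set y := (|Y⁻¹.trace| + 1)⁻¹ with hy
  set w := (|Y.trace| + 1)⁻¹ with hw
  have hy0 : 0 < y := by positivity
  have hw0 : 0 < w := by positivity
  have hYy : (Y - y • (1 : Matrix (Fin g) (Fin g) ℝ)).PosSemidef :=
    hYp.sub_inv_trace_smul_one (by positivity) (by linarith [le_abs_self Y⁻¹.trace])
  have hWw : (Y⁻¹ - w • (1 : Matrix (Fin g) (Fin g) ℝ)).PosSemidef :=
    hYp.inv.sub_inv_trace_smul_one (by positivity) (by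
      rw [Matrix.nonsing_inv_nonsing_inv _ hYu]; linarith [le_abs_self Y.trace])
  have hXX : (X * Xᵀ).PosSemidef := by
    simpa [conjTranspose_eq_transpose_of_trivial] using posSemidef_self_mul_conjTranspose X
  set t := (X * Xᵀ).trace with ht
  have ht0 : 0 ≤ t := hXX.trace_nonneg
  have hXt := hXX.trace_smul_one_sub
  rw [← ht] at hXt
  set κ := min (w / 2) (y / (2 * t + 1)) with hκ
  have hκ0 : 0 < κ := by positivity
  have hκw : 0 ≤ w - 2 * κ := by linarith [min_le_left (w / 2) (y / (2 * t + 1))]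
  have hκy : 0 ≤ y - κ * (2 * t + 1) := by
    have h1 : κ ≤ y / (2 * t + 1) := min_le_right _ _
    rw [le_div_iff₀ (by positivity)] at h1
    linarith
  refine ⟨(κ ^ g)⁻¹, fun Z' h => ?_⟩
  obtain ⟨A, B, C, D, hM, hE⟩ := h
  set c := C.map (Int.cast : ℤ → ℝ) with hc
  set d := D.map (Int.cast : ℤ → ℝ) with hd
  set P := c * X + d with hP
  have h1 := imR_mul_eq_one hM hZ hE hc hd hX hY hYW hP
  obtain ⟨hGp, hGd⟩ := one_le_det_of_symplectic hM hc hd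
  have hsq : ∀ M : Matrix (Fin g) (Fin g) ℝ, (M * Mᵀ).PosSemidef := fun M => by
    simpa [conjTranspose_eq_transpose_of_trivial] using posSemidef_self_mul_conjTranspose M
  have hdiff : ((P * Y⁻¹ * Pᵀ + c * Y * cᵀ) - κ • (c * cᵀ + d * dᵀ)).PosSemidef := by
    have hd' : d = P - c * X := by rw [hP]; abel
    have e : (P * Y⁻¹ * Pᵀ + c * Y * cᵀ) - κ • (c * cᵀ + d * dᵀ) =
        P * (Y⁻¹ - w • (1 : Matrix (Fin g) (Fin g) ℝ)) * Pᵀ +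
        c * (Y - y • (1 : Matrix (Fin g) (Fin g) ℝ)) * cᵀ +
        κ • ((P + c * X) * (P + c * X)ᵀ) +
        (2 * κ) • (c * (t • (1 : Matrix (Fin g) (Fin g) ℝ) - X * Xᵀ) * cᵀ) +
        (w - 2 * κ) • (P * Pᵀ) + (y - κ * (2 * t + 1)) • (c * cᵀ) := by
      rw [hd']
      simp only [transpose_add, transpose_sub, transpose_mul, Matrix.mul_add, Matrix.add_mul,
        Matrix.mul_sub, Matrix.sub_mul, Matrix.smul_mul, Matrix.mul_smul, Matrix.mul_one,
        Matrix.mul_assoc]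
      module
    rw [e]
    exact ((((((hWw.conj_transpose P).add (hYy.conj_transpose c)).add
      ((hsq _).smul hκ0.le)).add ((hXt.conj_transpose c).smul (by positivity))).add
      ((hsq _).smul hκw)).add ((hsq _).smul hκy))
  have h2 := (hGp.smul hκ0).det_le_det hdiff
  rw [det_smul, Fintype.card_fin] at h2
  have h3 := congrArg Matrix.det h1
  rw [det_mul, det_one] at h3
  have h4 : κ ^ g ≤ (P * Y⁻¹ * Pᵀ + c * Y * cᵀ).det :=
    le_trans (le_mul_of_one_le_right (by positivity) hGd) h2
  have h5 : 0 < κ ^ g := by positivity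
  have h6 : (imR Z').det = (P * Y⁻¹ * Pᵀ + c * Y * cᵀ).det⁻¹ :=
    eq_inv_of_mul_eq_one_left h3
  rw [h6]
  exact inv_anti₀ h5 h4

end OrbitBound

section Reduction

variable {g : ℕ}

lemma det_intConj {U V : Matrix (Fin g) (Fin g) ℤ} (hUV : U * V = 1)
    (W : Matrix (Fin g) (Fin g) ℝ) : (intConj U W).det = W.det := by
  have h1 : U.det * V.det = 1 := by rw [← det_mul, hUV, det_one]
  have h2 : (U.map (Int.cast : ℤ → ℝ)).det = ((U.det : ℤ) : ℝ) :=
    (RingHom.map_det (Int.castRingHom ℝ) U).symm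
  rw [intConj, det_mul, det_mul, det_transpose, h2]
  rcases Int.isUnit_iff.mp (IsUnit.of_mul_eq_one _ h1) with h | h <;> simp [h]

lemma intConj_apply_self (U : Matrix (Fin g) (Fin g) ℤ) (W : Matrix (Fin g) (Fin g) ℝ)
    (i : Fin g) : intConj U W i i = quadVal W (fun j => (U i j : ℝ)) := by
  simp only [intConj, quadVal, Matrix.mul_apply, transpose_apply, map_apply, Finset.sum_mul]
  rw [Finset.sum_comm]
  exact Finset.sum_congr rfl fun a _ => Finset.sum_congr rfl fun b _ => by ring

/-- A point of an orbit whose imaginary part has almost maximal determinant has imaginary part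
bounded below on primitive vectors. -/
lemma half_le_quadVal {Z : Matrix (Fin g) (Fin g) ℂ} (hZ : Z ∈ SiegelUpperHalf g)
    (hmax : ∀ Z', SpRel Z Z' → (imR Z').det ≤ 2 * (imR Z).det)
    {U V : Matrix (Fin g) (Fin g) ℤ} (hUV : U * V = 1) (i : Fin g) :
    1 / 2 ≤ quadVal (imR Z) (fun j => (U i j : ℝ)) := by
  set Z₂ := intC U * Z * (intC U)ᵀ with hZ₂
  have h2 : SpRel Z Z₂ := spRel_conj hUV Z
  set S : Matrix (Fin g) (Fin g) ℤ := Matrix.single i i (-round (Z₂ i i).re) with hS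
  have hSs : Sᵀ = S := by simp [hS]
  have h3 := h2.trans (spRel_add hSs Z₂)
  obtain ⟨Z₄, h4, h5⟩ := exists_spRel_inversion i (h3.mem_upperHalf hZ)
  have h6 := hmax _ (h3.trans h4)
  have hdet : (imR Z₂).det = (imR Z).det := by rw [hZ₂, imR_conj, det_intConj hUV]
  rw [imR_add_intC, hdet] at h5
  have hpos : 0 < (imR Z).det := Matrix.PosDef.det_pos hZ.2
  have h7 : 1 / 2 ≤ ‖(Z₂ + intC S) i i‖ ^ 2 := by
    by_contra hlt
    push Not at hlt
    have h8 : 0 < (imR Z₄).det :=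
      Matrix.PosDef.det_pos (((h3.trans h4).mem_upperHalf hZ).2)
    nlinarith
  have hre : ((Z₂ + intC S) i i).re = (Z₂ i i).re - round (Z₂ i i).re := by
    simp [hS, sub_eq_add_neg]
  have him : ((Z₂ + intC S) i i).im = quadVal (imR Z) (fun j => (U i j : ℝ)) := by
    have : ((Z₂ + intC S) i i).im = imR Z₂ i i := by simp
    rw [this, hZ₂, imR_conj, intConj_apply_self]
  rw [← Complex.normSq_eq_norm_sq, Complex.normSq_apply, hre, him] at h7
  have h9 := abs_le.mp (abs_sub_round (Z₂ i i).re)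
  have hq : 0 ≤ quadVal (imR Z) (fun j => (U i j : ℝ)) := by
    rw [quadVal_eq_dotProduct]
    have hp : (imR Z).PosDef := hZ.2
    simpa using hp.posSemidef.dotProduct_mulVec_nonneg (fun j => (U i j : ℝ))
  nlinarith

lemma dualBounded_inv {Y : Matrix (Fin g) (Fin g) ℝ} (hY : Y.PosDef)
    (h : ∀ U V : Matrix (Fin g) (Fin g) ℤ, U * V = 1 → ∀ i,
      1 / 2 ≤ quadVal Y (fun j => (U i j : ℝ))) : DualBounded Y⁻¹ 2 := by
  intro U V hUV i
  have h1 := h Vᵀ Uᵀ (by rw [← transpose_mul, hUV, transpose_one]) i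
  simp only [transpose_apply] at h1
  set v : Fin g → ℝ := fun j => (V j i : ℝ) with hv
  set q := quadVal Y v with hq
  have hq0 : 0 < q := by linarith
  have hu : IsUnit Y.det := (isUnit_iff_isUnit_det _).mp hY.isUnit
  refine ⟨q⁻¹ • (Y *ᵥ v), ?_, ?_⟩
  · have : ∑ j, (V j i : ℝ) * (q⁻¹ • (Y *ᵥ v)) j = v ⬝ᵥ (q⁻¹ • (Y *ᵥ v)) := rfl
    rw [this, dotProduct_smul, ← quadVal_eq_dotProduct, smul_eq_mul, ← hq,
      inv_mul_cancel₀ hq0.ne']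
  · rw [quadVal_eq_dotProduct, mulVec_smul, mulVec_mulVec, Matrix.nonsing_inv_mul _ hu,
      one_mulVec, dotProduct_smul, smul_dotProduct, dotProduct_comm, ← quadVal_eq_dotProduct, ← hq,
      smul_eq_mul, smul_eq_mul, inv_mul_cancel₀ hq0.ne', mul_one]
    rw [inv_le_comm₀ hq0 (by norm_num)]
    linarith

/-- Every orbit has a point `Z'` for which the trace of `(Im Z')⁻¹` is bounded in terms of the
genus only. -/
theorem exists_reduced {Z : Matrix (Fin g) (Fin g) ℂ} (hZ : Z ∈ SiegelUpperHalf g) :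
    ∃ Z', SpRel Z Z' ∧ (imR Z')⁻¹.trace ≤ g * 2 ^ (g + 1) := by
  obtain ⟨b, hb⟩ := exists_det_bound hZ
  set O : Set ℝ := {x | ∃ Z', SpRel Z Z' ∧ (imR Z').det = x} with hO
  have hne : (imR Z).det ∈ O := ⟨Z, SpRel.refl Z, rfl⟩
  have hbdd : BddAbove O := ⟨b, by rintro x ⟨Z', h, rfl⟩; exact hb Z' h⟩
  have hpos : 0 < sSup O := lt_of_lt_of_le (Matrix.PosDef.det_pos hZ.2) (le_csSup hbdd hne)
  obtain ⟨x, ⟨Z₁, h1, rfl⟩, hx⟩ := exists_lt_of_lt_csSup ⟨_, hne⟩ (half_lt_self hpos)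
  have hZ₁ := h1.mem_upperHalf hZ
  have hmax : ∀ Z', SpRel Z₁ Z' → (imR Z').det ≤ 2 * (imR Z₁).det := fun Z' h => by
    have := le_csSup hbdd ⟨Z', h1.trans h, rfl⟩
    linarith
  have hY : (imR Z₁).PosDef := hZ₁.2
  have hu : IsUnit (imR Z₁).det := (isUnit_iff_isUnit_det _).mp hY.isUnit
  have hD : DualBounded (imR Z₁)⁻¹ 2 :=
    dualBounded_inv hY fun U V hUV i => half_le_quadVal hZ₁ hmax hUV i
  have hWs : ((imR Z₁)⁻¹)ᵀ = (imR Z₁)⁻¹ := by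
    simpa [IsHermitian, conjTranspose_eq_transpose_of_trivial] using hY.inv.isHermitian
  obtain ⟨U, V, hUV, hshort⟩ := exists_short_basis (imR Z₁)⁻¹ 2 (by norm_num) hWs
    (fun x hx => by
      rw [quadVal_eq_dotProduct]
      simpa using hY.inv.dotProduct_mulVec_pos hx) hD
  have hVU : Vᵀ * Uᵀ = 1 := by rw [← transpose_mul, hUV, transpose_one]
  refine ⟨_, h1.trans (spRel_conj hVU Z₁), ?_⟩
  have hinv : (imR (intC Vᵀ * Z₁ * (intC Vᵀ)ᵀ))⁻¹ = intConj U (imR Z₁)⁻¹ := by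
    rw [imR_conj]
    apply Matrix.inv_eq_right_inv
    have e1 : (Vᵀ.map (Int.cast : ℤ → ℝ))ᵀ * U.map (Int.cast : ℤ → ℝ) = 1 := by
      rw [← transpose_map, transpose_transpose, ← map_intCast_mul, mul_eq_one_comm.mp hUV,
        map_intCast_one]
    have e2 : Vᵀ.map (Int.cast : ℤ → ℝ) * (U.map (Int.cast : ℤ → ℝ))ᵀ = 1 := by
      rw [← transpose_map, ← map_intCast_mul, hVU, map_intCast_one]
    calc intConj Vᵀ (imR Z₁) * intConj U (imR Z₁)⁻¹
        = Vᵀ.map (Int.cast : ℤ → ℝ) * imR Z₁ * ((Vᵀ.map (Int.cast : ℤ → ℝ))ᵀ *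
            U.map (Int.cast : ℤ → ℝ)) * (imR Z₁)⁻¹ * (U.map (Int.cast : ℤ → ℝ))ᵀ := by
          simp only [intConj, Matrix.mul_assoc]
      _ = 1 := by
          rw [e1, Matrix.mul_one, Matrix.mul_nonsing_inv_cancel_right _ _ hu, e2]
  rw [hinv, Matrix.trace]
  calc ∑ i, (intConj U (imR Z₁)⁻¹).diag i ≤ ∑ _i : Fin g, (2 : ℝ) ^ g * 2 :=
        Finset.sum_le_sum fun i _ => by
          rw [diag_apply, intConj_apply_self]; exact hshort i
    _ = g * 2 ^ (g + 1) := by simp [pow_succ]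

end Reduction

section FourierSeries

variable {g k : ℕ}

/-- The type of positive definite half-integral matrices. -/
abbrev HalfInt (g : ℕ) := {T : Matrix (Fin g) (Fin g) ℝ // IsPDHalfIntegral T}

/-- A term of the Fourier expansion. -/
def fourierTerm (F : SiegelCuspForm g k) (Z : Matrix (Fin g) (Fin g) ℂ) (T : HalfInt g) : ℂ :=
  F.coeff T.1 * Complex.exp (2 * Real.pi * Complex.I * (T.1.map (Complex.ofReal) * Z).trace)

lemma trace_realC_mul_im (T : Matrix (Fin g) (Fin g) ℝ) (Z : Matrix (Fin g) (Fin g) ℂ) :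
    (realC T * Z).trace.im = (T * imR Z).trace := by
  simp [Matrix.trace, Matrix.mul_apply]

lemma norm_fourierTerm (F : SiegelCuspForm g k) (Z : Matrix (Fin g) (Fin g) ℂ) (T : HalfInt g) :
    ‖fourierTerm F Z T‖ = ‖F.coeff T.1‖ * Real.exp (-(2 * Real.pi * (T.1 * imR Z).trace)) := by
  rw [fourierTerm, norm_mul, Complex.norm_exp, ← trace_realC_mul_im]
  congr 2
  simp

lemma norm_fourierTerm_le_of_le (F : SiegelCuspForm g k) {Z Z' : Matrix (Fin g) (Fin g) ℂ}
    (h : (imR Z - imR Z').PosSemidef) (T : HalfInt g) :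
    ‖fourierTerm F Z T‖ ≤ ‖fourierTerm F Z' T‖ := by
  rw [norm_fourierTerm, norm_fourierTerm]
  have h1 := T.2.2.1.posSemidef.trace_mul_nonneg h
  rw [Matrix.mul_sub, trace_sub] at h1
  gcongr
  linarith

lemma imR_affine (X Y : Matrix (Fin g) (Fin g) ℝ) (w : ℂ) :
    imR (realC X + w • realC Y) = w.im • Y := by
  ext i j
  simp

lemma affine_mem {X Y : Matrix (Fin g) (Fin g) ℝ} (hX : Xᵀ = X) (hY : Y.PosDef) {w : ℂ}
    (hw : 0 < w.im) : realC X + w • realC Y ∈ SiegelUpperHalf g := by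
  refine ⟨?_, ?_⟩
  · have hYs : Yᵀ = Y := by
      simpa [IsHermitian, conjTranspose_eq_transpose_of_trivial] using hY.isHermitian
    rw [IsSymm, transpose_add, transpose_smul, ← transpose_map, ← transpose_map, hX, hYs]
  · have := imR_affine X Y w
    rw [imR] at this
    rw [this]
    exact hY.smul hw

lemma re_symm {Z : Matrix (Fin g) (Fin g) ℂ} (hZ : Z ∈ SiegelUpperHalf g) :
    (Z.map Complex.re)ᵀ = Z.map Complex.re := by
  rw [← transpose_map, hZ.1]

/-- The Fourier series of a non-zero cusp form converges absolutely everywhere. -/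
lemma summable_fourierTerm (F : SiegelCuspForm g k)
    (hF : ∃ Z ∈ SiegelUpperHalf g, F.toFun Z ≠ 0) {Z : Matrix (Fin g) (Fin g) ℂ}
    (hZ : Z ∈ SiegelUpperHalf g) : Summable (fourierTerm F Z) := by
  by_contra hns
  obtain ⟨Z₁, hZ₁, hne⟩ := hF
  have hvanish : ∀ Z' ∈ SiegelUpperHalf g, (imR Z - imR Z').PosSemidef → F.toFun Z' = 0 := by
    intro Z' hZ' hle
    rw [F.fourier Z' hZ']
    apply tsum_eq_zero_of_not_summable
    intro hs
    refine hns (Summable.of_norm_bounded (summable_norm_iff.mpr hs) fun T => ?_)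
    exact norm_fourierTerm_le_of_le F hle T
  set X := Z₁.map Complex.re with hX
  set Y := imR Z₁ with hYdef
  have hY : Y.PosDef := hZ₁.2
  have hY0 : (imR Z).PosDef := hZ.2
  set y := (|(imR Z)⁻¹.trace| + 1)⁻¹ with hy
  have hy0 : 0 < y := by positivity
  have hYy : (imR Z - y • (1 : Matrix (Fin g) (Fin g) ℝ)).PosSemidef :=
    hY0.sub_inv_trace_smul_one (by positivity) (by linarith [le_abs_self (imR Z)⁻¹.trace])
  have htr : 0 ≤ Y.trace := hY.posSemidef.trace_nonneg
  set c := y / (Y.trace + 1) with hc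
  have hc0 : 0 < c := by positivity
  have hle : ∀ s : ℝ, 0 ≤ s → s ≤ c → (imR Z - s • Y).PosSemidef := by
    intro s hs0 hsc
    have e : imR Z - s • Y = (imR Z - y • (1 : Matrix (Fin g) (Fin g) ℝ)) +
        s • (Y.trace • (1 : Matrix (Fin g) (Fin g) ℝ) - Y) +
        (y - s * Y.trace) • (1 : Matrix (Fin g) (Fin g) ℝ) := by module
    rw [e]
    have h1 : 0 ≤ y - s * Y.trace := by
      have : s * Y.trace ≤ c * (Y.trace + 1) := by nlinarith
      rw [hc, div_mul_cancel₀ _ (by positivity)] at this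
      linarith
    exact (hYy.add (hY.posSemidef.trace_smul_one_sub.smul hs0)).add
      (Matrix.PosSemidef.one.smul h1)
  set f : ℂ → ℂ := fun w => F.toFun (realC X + w • realC Y) with hf
  have hopen : IsOpen {w : ℂ | 0 < w.im} := isOpen_lt continuous_const Complex.continuous_im
  have hdiff : DifferentiableOn ℂ f {w : ℂ | 0 < w.im} := by
    refine F.holo.comp ?_ fun w hw => affine_mem (re_symm hZ₁) hY hw
    exact ((differentiable_id.smul_const _).const_add _).differentiableOn
  have han := hdiff.analyticOnNhd hopen
  have hz : f =ᶠ[nhds ((c / 2 : ℝ) * Complex.I)] 0 := by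
    have hmem : {w : ℂ | 0 < w.im} ∩ {w : ℂ | w.im < c} ∈ nhds (((c / 2 : ℝ) : ℂ) * Complex.I) := by
      refine (hopen.inter (isOpen_lt Complex.continuous_im continuous_const)).mem_nhds ?_
      constructor
      · simp [hc0]
      · simp [hc0]
    filter_upwards [hmem] with w hw
    refine hvanish _ (affine_mem (re_symm hZ₁) hY hw.1) ?_
    rw [imR_affine]
    exact hle _ (le_of_lt hw.1) (le_of_lt hw.2)
  have hconn : IsPreconnected {w : ℂ | 0 < w.im} :=
    (convex_halfSpace_im_gt 0).isPreconnected
  have hmem0 : ((c / 2 : ℝ) : ℂ) * Complex.I ∈ {w : ℂ | 0 < w.im} := by simp [hc0]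
  have h0 := han.eqOn_zero_of_preconnected_of_eventuallyEq_zero hconn hmem0 hz
    (show Complex.I ∈ {w : ℂ | 0 < w.im} by simp)
  apply hne
  rw [eq_re_add_im Z₁]
  exact h0

lemma hasSum_fourierTerm (F : SiegelCuspForm g k)
    (hF : ∃ Z ∈ SiegelUpperHalf g, F.toFun Z ≠ 0) {Z : Matrix (Fin g) (Fin g) ℂ}
    (hZ : Z ∈ SiegelUpperHalf g) : HasSum (fourierTerm F Z) (F.toFun Z) := by
  have := (summable_fourierTerm F hF hZ).hasSum
  rwa [show ∑' T, fourierTerm F Z T = F.toFun Z from (F.fourier Z hZ).symm] at this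

/-- The trace of a half-integral matrix is a natural number. -/
lemma HalfInt.exists_trace (T : HalfInt g) : ∃ n : ℕ, T.1.trace = n := by
  choose n hn using T.2.2.2.1
  have h1 : T.1.trace = ((∑ i, n i : ℤ) : ℝ) := by
    simp [Matrix.trace, hn]
  have h2 := T.2.2.1.posSemidef.trace_nonneg
  rw [h1] at h2
  obtain ⟨m, hm⟩ := Int.eq_ofNat_of_zero_le (show 0 ≤ ∑ i, n i by exact_mod_cast h2)
  exact ⟨m, by rw [h1, hm]; simp⟩

lemma HalfInt.det_ge (T : HalfInt g) : 1 ≤ 2 ^ g * T.1.det := by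
  obtain ⟨-, hp, hd, ho⟩ := T.2
  have h1 : ∀ i j, ∃ n : ℤ, ((2 : ℝ) • T.1) i j = n := by
    intro i j
    by_cases h : i = j
    · subst h
      obtain ⟨n, hn⟩ := hd i
      exact ⟨2 * n, by simp [hn]⟩
    · obtain ⟨n, hn⟩ := ho i j h
      exact ⟨n, by simp [hn]; ring⟩
  choose N hN using h1
  have h2 : (2 : ℝ) • T.1 = (Matrix.of N).map (Int.cast : ℤ → ℝ) := by
    ext i j
    exact hN i j
  have h3 : ((2 : ℝ) • T.1).det = (((Matrix.of N).det : ℤ) : ℝ) := by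
    rw [h2]
    exact (RingHom.map_det (Int.castRingHom ℝ) _).symm
  have h4 := (hp.smul (show (0 : ℝ) < 2 by norm_num)).det_pos
  rw [h3] at h4
  rw [det_smul, Fintype.card_fin] at h3
  rw [h3]
  exact_mod_cast h4

end FourierSeries

section PeterssonBound

variable {g : ℕ}

lemma Matrix.PosDef.inv_mul_trace_le {Y T : Matrix (Fin g) (Fin g) ℝ} (hY : Y.PosDef)
    (hT : T.PosSemidef) {r : ℝ} (hr0 : 0 < r) (hr : Y⁻¹.trace ≤ r) :
    r⁻¹ * T.trace ≤ (T * Y).trace := by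
  have h := hT.trace_mul_nonneg (hY.sub_inv_trace_smul_one hr0 hr)
  rw [Matrix.mul_sub, trace_sub, Matrix.mul_smul, Matrix.mul_one, trace_smul, smul_eq_mul] at h
  linarith

lemma Matrix.PosSemidef.det_mul_det_le {T Y : Matrix (Fin g) (Fin g) ℝ} (hT : T.PosSemidef)
    (hY : Y.PosSemidef) : T.det * Y.det ≤ (T * Y).trace ^ g := by
  obtain ⟨S, hS, rfl⟩ := hT.exists_symm_sqrt
  have h := (hY.conj_transpose S).det_le_trace_pow
  rw [hS, Fintype.card_fin, det_mul, det_mul, Matrix.trace_mul_comm, ← Matrix.mul_assoc] at h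
  rw [det_mul]
  linarith

lemma det_le_two_trace_pow (T : HalfInt g) {Y : Matrix (Fin g) (Fin g) ℝ} (hY : Y.PosDef) :
    Y.det ≤ (2 * (T.1 * Y).trace) ^ g := by
  have h1 := T.2.2.1.posSemidef.det_mul_det_le hY.posSemidef
  have h2 := T.det_ge
  have h3 := hY.det_pos
  calc Y.det ≤ 2 ^ g * T.1.det * Y.det := le_mul_of_one_le_left h3.le h2
    _ = 2 ^ g * (T.1.det * Y.det) := by ring
    _ ≤ 2 ^ g * (T.1 * Y).trace ^ g := by gcongr
    _ = _ := by rw [mul_pow]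

lemma scalar_mem {y : ℝ} (hy : 0 < y) : (((y : ℂ) * Complex.I) • (1 : Matrix (Fin g) (Fin g) ℂ)) ∈
    SiegelUpperHalf g := by
  have := affine_mem (g := g) (X := 0) (Y := 1) (by simp) Matrix.PosDef.one
    (w := (y : ℂ) * Complex.I) (by simpa using hy)
  simpa [realC] using this

lemma imR_smul_one (τ : ℂ) : imR (τ • (1 : Matrix (Fin g) (Fin g) ℂ)) =
    τ.im • (1 : Matrix (Fin g) (Fin g) ℝ) := by
  have := imR_affine (0 : Matrix (Fin g) (Fin g) ℝ) 1 τ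
  simpa [realC] using this

lemma petersson_le_of_reduced {l : ℕ} (F : SiegelCuspForm g (2 * l))
    (hF : ∃ Z ∈ SiegelUpperHalf g, F.toFun Z ≠ 0) {r : ℝ} (hr : 0 < r) :
    ∃ b, ∀ Z ∈ SiegelUpperHalf g, (imR Z)⁻¹.trace ≤ r → petersson l F.toFun Z ≤ b := by
  have hs := (summable_norm_iff.mpr (summable_fourierTerm F hF
    (scalar_mem (y := r⁻¹ / 2) (by positivity)))).mul_left ((2 : ℝ) ^ (g * l) * (g * l).factorial)
  refine ⟨∑' T, (2 : ℝ) ^ (g * l) * (g * l).factorial *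
    ‖fourierTerm F ((((r⁻¹ / 2 : ℝ) : ℂ) * Complex.I) • 1) T‖, fun Z hZ hZr => ?_⟩
  have hY : (imR Z).PosDef := hZ.2
  have h1 := (summable_norm_iff.mpr (summable_fourierTerm F hF hZ)).mul_left ((imR Z).det ^ l)
  have h2 : petersson l F.toFun Z ≤ ∑' T, (imR Z).det ^ l * ‖fourierTerm F Z T‖ := by
    rw [tsum_mul_left, petersson, ← (hasSum_fourierTerm F hF hZ).tsum_eq]
    have := hY.det_pos
    gcongr
    exact norm_tsum_le_tsum_norm (summable_norm_iff.mpr (summable_fourierTerm F hF hZ))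
  refine h2.trans (h1.tsum_le_tsum (fun T => ?_) hs)
  rw [norm_fourierTerm, norm_fourierTerm, imR_smul_one]
  have him : (((r⁻¹ / 2 : ℝ) : ℂ) * Complex.I).im = r⁻¹ / 2 := by simp
  rw [him, Matrix.mul_smul, Matrix.mul_one, trace_smul, smul_eq_mul]
  set t := (T.1 * imR Z).trace with ht
  have ht1 : r⁻¹ * T.1.trace ≤ t := hY.inv_mul_trace_le T.2.2.1.posSemidef hr hZr
  have ht0 : 0 ≤ t := T.2.2.1.posSemidef.trace_mul_nonneg hY.posSemidef
  have hd : (imR Z).det ^ l ≤ 2 ^ (g * l) * ((g * l).factorial * Real.exp t) := by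
    calc (imR Z).det ^ l ≤ ((2 * t) ^ g) ^ l :=
          pow_le_pow_left₀ hY.det_pos.le (det_le_two_trace_pow T hY) l
      _ = 2 ^ (g * l) * t ^ (g * l) := by rw [← pow_mul, mul_pow]
      _ ≤ _ := by
        gcongr
        have := Real.pow_div_factorial_le_exp t ht0 (g * l)
        rwa [div_le_iff₀ (by positivity), mul_comm (Real.exp t)] at this
  have he : Real.exp t * Real.exp (-(2 * Real.pi * t)) ≤
      Real.exp (-(2 * Real.pi * (r⁻¹ / 2 * T.1.trace))) := by
    rw [← Real.exp_add]
    apply Real.exp_le_exp.mpr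
    have hpi := Real.pi_gt_three
    nlinarith
  calc (imR Z).det ^ l * (‖F.coeff T.1‖ * Real.exp (-(2 * Real.pi * t)))
      ≤ (2 ^ (g * l) * ((g * l).factorial * Real.exp t)) *
        (‖F.coeff T.1‖ * Real.exp (-(2 * Real.pi * t))) := by gcongr
    _ = 2 ^ (g * l) * (g * l).factorial * (‖F.coeff T.1‖ *
        (Real.exp t * Real.exp (-(2 * Real.pi * t)))) := by ring
    _ ≤ _ := by gcongr

/-- The function `det(Im Z)^l |F(Z)|` of a cusp form of weight `2l` is bounded. -/
lemma exists_petersson_le {l : ℕ} (hg : 0 < g) (F : SiegelCuspForm g (2 * l))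
    (hF : ∃ Z ∈ SiegelUpperHalf g, F.toFun Z ≠ 0) :
    ∃ b, ∀ Z ∈ SiegelUpperHalf g, petersson l F.toFun Z ≤ b := by
  obtain ⟨b, hb⟩ := petersson_le_of_reduced F hF (r := g * 2 ^ (g + 1)) (by positivity)
  refine ⟨b, fun Z hZ => ?_⟩
  obtain ⟨Z', h, hr⟩ := exists_reduced hZ
  rw [← h.petersson_eq F hZ]
  exact hb Z' (h.mem_upperHalf hZ) hr

end PeterssonBound

section FourierCoefficients

/-- A Fourier coefficient of an absolutely convergent Fourier series is bounded by the supremum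
of the series. -/
lemma norm_coeff_le_of_hasSum {d : ℕ → ℂ} {G : ℝ → ℂ} {S : ℝ} (hs : Summable fun n => ‖d n‖)
    (hG : ∀ x : ℝ, HasSum (fun n : ℕ => d n * Complex.exp (2 * Real.pi * Complex.I * n * x)) (G x))
    (hb : ∀ x, ‖G x‖ ≤ S) (n : ℕ) : ‖d n‖ ≤ S := by
  set E : ℕ → ℝ → ℂ := fun m x => d m * Complex.exp (2 * Real.pi * Complex.I * (m - n : ℂ) * x)
    with hE
  have hcont : ∀ m, Continuous (E m) := fun m => by fun_prop
  have hnorm : ∀ a x : ℝ, ‖Complex.exp (2 * Real.pi * Complex.I * a * x)‖ = 1 := fun a x => by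
    rw [Complex.norm_exp]; simp
  have hEn : ∀ m x, ‖E m x‖ = ‖d m‖ := fun m x => by
    have := hnorm (m - n) x
    push_cast at this
    rw [hE, norm_mul, this, mul_one]
  have hlim : ∀ x : ℝ, HasSum (fun m => E m x)
      (G x * Complex.exp (2 * Real.pi * Complex.I * (-n : ℂ) * x)) := fun x => by
    refine ((hG x).mul_right (Complex.exp (2 * Real.pi * Complex.I * (-n : ℂ) * x))).congr_fun ?_
    intro m
    simp only [hE]
    rw [mul_assoc (d m), ← Complex.exp_add]
    congr 2
    ring
  have hint := intervalIntegral.hasSum_integral_of_dominated_convergence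
    (μ := MeasureTheory.volume) (a := 0) (b := 1) (fun m _ => ‖d m‖)
    (fun m => (hcont m).aestronglyMeasurable)
    (fun m => Filter.Eventually.of_forall fun x _ => (hEn m x).le)
    (Filter.Eventually.of_forall fun x _ => hs) (by simp)
    (Filter.Eventually.of_forall fun x _ => hlim x)
  have hval : ∀ m, m ≠ n → ∫ x in (0 : ℝ)..1, E m x = 0 := fun m hm => by
    have hmn : ((m : ℂ) - n) ≠ 0 := sub_ne_zero.mpr (by exact_mod_cast hm)
    have hne : 2 * Real.pi * Complex.I * (m - n : ℂ) ≠ 0 := by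
      simp [hmn, Real.pi_ne_zero]
    rw [intervalIntegral.integral_const_mul, integral_exp_mul_complex hne]
    have h1 : Complex.exp (2 * Real.pi * Complex.I * (m - n : ℂ) * (1 : ℝ)) = 1 := by
      rw [Complex.exp_eq_one_iff]
      exact ⟨(m : ℤ) - n, by push_cast; ring⟩
    rw [h1]
    simp
  have hvaln : ∫ x in (0 : ℝ)..1, E n x = d n := by simp [hE]
  have h1 := hint.unique (hasSum_single n hval)
  rw [hvaln] at h1
  rw [← h1]
  have := intervalIntegral.norm_integral_le_of_norm_le_const (a := (0 : ℝ)) (b := 1) (C := S)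
    (f := fun x : ℝ => G x * Complex.exp (2 * Real.pi * Complex.I * (-n : ℂ) * x)) (fun x _ => by
      have h2 := hnorm (-n) x
      push_cast at h2
      rw [norm_mul, h2, mul_one]
      exact hb x)
  simpa using this

lemma HasSum.fiberwise {ι : Type*} {u : ι → ℂ} {s : ℂ} (h : HasSum u s) (ν : ι → ℕ) :
    HasSum (fun n => ∑' i : {i // ν i = n}, u i) s := by
  have h1 := (Equiv.sigmaFiberEquiv ν).hasSum_iff.mpr h
  exact h1.sigma fun n => (h1.summable.sigma_factor n).hasSum

lemma Summable.norm_fiberwise {ι : Type*} {u : ι → ℂ} (h : Summable u) (ν : ι → ℕ) :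
    Summable fun n => ‖∑' i : {i // ν i = n}, u i‖ := by
  have h1 := (Equiv.sigmaFiberEquiv ν).summable_iff.mpr (summable_norm_iff.mpr h)
  refine Summable.of_norm_bounded h1.sigma fun n => ?_
  rw [norm_norm]
  exact norm_tsum_le_tsum_norm (h1.sigma_factor n)

variable {g k : ℕ}

/-- The trace of a half-integral matrix, as a natural number. -/
def HalfInt.tr (T : HalfInt g) : ℕ := T.exists_trace.choose

lemma HalfInt.tr_eq (T : HalfInt g) : T.1.trace = T.tr := T.exists_trace.choose_spec

/-- The sum of the Fourier terms of given trace. -/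
def traceCoeff (F : SiegelCuspForm g k) (Z : Matrix (Fin g) (Fin g) ℂ) (n : ℕ) : ℂ :=
  ∑' T : {T : HalfInt g // T.tr = n}, fourierTerm F Z T.1

lemma fourierTerm_add_smul_one (F : SiegelCuspForm g k) (Z : Matrix (Fin g) (Fin g) ℂ) (τ : ℂ)
    (T : HalfInt g) : fourierTerm F (Z + τ • 1) T =
      fourierTerm F Z T * Complex.exp (2 * Real.pi * Complex.I * T.tr * τ) := by
  have h1 : (realC T.1).trace = (T.tr : ℂ) := by
    have := congrArg Complex.ofReal T.tr_eq
    simpa [Matrix.trace] using this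
  rw [fourierTerm, fourierTerm, mul_assoc (F.coeff T.1), ← Complex.exp_add, Matrix.mul_add, trace_add,
    Matrix.mul_smul, Matrix.mul_one, trace_smul, show (T.1.map Complex.ofReal).trace = (T.tr : ℂ)
      from h1, smul_eq_mul]
  congr 2
  ring

lemma traceCoeff_add_smul_one (F : SiegelCuspForm g k) (Z : Matrix (Fin g) (Fin g) ℂ) (τ : ℂ)
    (n : ℕ) : traceCoeff F (Z + τ • 1) n =
      traceCoeff F Z n * Complex.exp (2 * Real.pi * Complex.I * n * τ) := by
  rw [traceCoeff, traceCoeff, ← tsum_mul_right]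
  refine tsum_congr fun T => ?_
  rw [fourierTerm_add_smul_one, T.2]

lemma hasSum_traceCoeff (F : SiegelCuspForm g k)
    (hF : ∃ Z ∈ SiegelUpperHalf g, F.toFun Z ≠ 0) {Z : Matrix (Fin g) (Fin g) ℂ}
    (hZ : Z ∈ SiegelUpperHalf g) : HasSum (traceCoeff F Z) (F.toFun Z) :=
  (hasSum_fourierTerm F hF hZ).fiberwise _

lemma summable_norm_traceCoeff (F : SiegelCuspForm g k)
    (hF : ∃ Z ∈ SiegelUpperHalf g, F.toFun Z ≠ 0) {Z : Matrix (Fin g) (Fin g) ℂ}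
    (hZ : Z ∈ SiegelUpperHalf g) : Summable fun n => ‖traceCoeff F Z n‖ :=
  (summable_fourierTerm F hF hZ).norm_fiberwise _

lemma add_real_mem {Z : Matrix (Fin g) (Fin g) ℂ} (hZ : Z ∈ SiegelUpperHalf g) (x : ℝ) :
    Z + (x : ℂ) • (1 : Matrix (Fin g) (Fin g) ℂ) ∈ SiegelUpperHalf g ∧
      imR (Z + (x : ℂ) • (1 : Matrix (Fin g) (Fin g) ℂ)) = imR Z := by
  have h : imR (Z + (x : ℂ) • (1 : Matrix (Fin g) (Fin g) ℂ)) = imR Z := by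
    ext i j
    by_cases hij : i = j <;> simp [hij]
  refine ⟨⟨?_, ?_⟩, h⟩
  · rw [IsSymm, transpose_add, transpose_smul, transpose_one, hZ.1]
  · rw [show (Z + (x : ℂ) • (1 : Matrix (Fin g) (Fin g) ℂ)).map Complex.im = imR Z from h]
    exact hZ.2

/-- The bound on the coefficients of given trace that follows from a bound on the form. -/
lemma norm_traceCoeff_le {l : ℕ} (F : SiegelCuspForm g (2 * l))
    (hF : ∃ Z ∈ SiegelUpperHalf g, F.toFun Z ≠ 0) {M : ℝ}
    (hM : ∀ Z ∈ SiegelUpperHalf g, petersson l F.toFun Z ≤ M) {Z : Matrix (Fin g) (Fin g) ℂ}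
    (hZ : Z ∈ SiegelUpperHalf g) (n : ℕ) : ‖traceCoeff F Z n‖ ≤ M / (imR Z).det ^ l := by
  have hpos : 0 < (imR Z).det := Matrix.PosDef.det_pos hZ.2
  refine norm_coeff_le_of_hasSum (summable_norm_traceCoeff F hF hZ)
    (G := fun x => F.toFun (Z + (x : ℂ) • 1)) (fun x => ?_) (fun x => ?_) n
  · have := hasSum_traceCoeff F hF (add_real_mem hZ x).1
    rwa [funext (traceCoeff_add_smul_one F Z x)] at this
  · have := hM _ (add_real_mem hZ x).1
    rw [petersson, (add_real_mem hZ x).2] at this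
    rw [le_div_iff₀ (by positivity), mul_comm]
    exact this

end FourierCoefficients

section VanishingOrder

variable {g : ℕ}

lemma norm_cexp_mul_I (n : ℕ) (τ : ℂ) :
    ‖Complex.exp (2 * Real.pi * Complex.I * n * τ)‖ = Real.exp (-(2 * Real.pi * τ.im)) ^ n := by
  rw [Complex.norm_exp, ← Real.exp_nat_mul]
  congr 1
  simp
  ring

lemma two_pow_mul_exp_le {R N m : ℕ} (hR : 8 ≤ R) (hm : R * (N + R) ≤ m) :
    (2 : ℝ) ^ N * (Real.exp (-(2 * Real.pi * (R : ℝ)⁻¹)) ^ m *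
      (1 - Real.exp (-(2 * Real.pi * (R : ℝ)⁻¹)))⁻¹) ≤ 1 / 2 := by
  have hR' : (8 : ℝ) ≤ R := by exact_mod_cast hR
  have hR0 : (0 : ℝ) < R := by linarith
  have hpi := Real.pi_gt_three
  have hpi' := Real.pi_lt_four
  set x := 2 * Real.pi * (R : ℝ)⁻¹ with hx
  have hxR : x * R = 2 * Real.pi := by rw [hx]; field_simp
  have hx0 : 0 < x := by positivity
  have hx1 : x ≤ 1 := by nlinarith
  have hq : (R : ℝ)⁻¹ ≤ 1 - Real.exp (-x) := by
    have h1 := Real.add_one_le_exp x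
    have h2 : Real.exp (-x) ≤ (x + 1)⁻¹ := by
      rw [Real.exp_neg]
      exact inv_anti₀ (by linarith) h1
    have h3 : (R : ℝ)⁻¹ ≤ 1 - (x + 1)⁻¹ := by
      rw [show 1 - (x + 1)⁻¹ = x / (x + 1) by field_simp; ring, inv_le_iff_one_le_mul₀ hR0]
      rw [div_mul_eq_mul_div, hxR, le_div_iff₀ (by linarith)]
      linarith
    linarith
  have hinv : (1 - Real.exp (-x))⁻¹ ≤ R := by
    rw [inv_le_comm₀ (lt_of_lt_of_le (by positivity) hq) hR0]
    exact hq
  have hm' : (R : ℝ) * (N + R) ≤ m := by exact_mod_cast hm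
  have hpow : Real.exp (-x) ^ m ≤ Real.exp (-(N + 2 * R)) := by
    rw [← Real.exp_nat_mul]
    apply Real.exp_le_exp.mpr
    have h1 : x * (R * (N + R)) ≤ x * m := by gcongr
    rw [← mul_assoc, hxR] at h1
    nlinarith [Nat.cast_nonneg (α := ℝ) N]
  have h2N : (2 : ℝ) ^ N ≤ Real.exp N := by
    have := Real.add_one_le_exp (1 : ℝ)
    calc (2 : ℝ) ^ N ≤ Real.exp 1 ^ N := by gcongr; linarith
      _ = Real.exp N := by rw [← Real.exp_nat_mul, mul_one]
  calc (2 : ℝ) ^ N * (Real.exp (-x) ^ m * (1 - Real.exp (-x))⁻¹)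
      ≤ Real.exp N * (Real.exp (-(N + 2 * R)) * R) := by
        have : 0 ≤ (1 - Real.exp (-x))⁻¹ :=
          inv_nonneg.mpr (le_trans (by positivity) hq)
        gcongr
    _ = Real.exp (-(2 * R)) * R := by
        rw [← mul_assoc, ← Real.exp_add]
        congr 2
        ring
    _ ≤ 1 / 2 := by
        rw [Real.exp_neg, inv_mul_le_iff₀ (Real.exp_pos _)]
        linarith [Real.add_one_le_exp (2 * (R : ℝ))]

/-- A non-zero cusp form has a non-zero Fourier coefficient of small trace. -/
theorem exists_coeff_ne_zero {l m : ℕ} (hg : 0 < g) (F : SiegelCuspForm g (2 * l))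
    (hF : ∃ Z ∈ SiegelUpperHalf g, F.toFun Z ≠ 0)
    (hm : g * 2 ^ (g + 2) * (g * l + g * 2 ^ (g + 2)) ≤ m) :
    ∃ T : HalfInt g, T.tr < m ∧ F.coeff T.1 ≠ 0 := by
  by_contra! hcon
  obtain ⟨b, hb⟩ := exists_petersson_le hg F hF
  set O : Set ℝ := petersson l F.toFun '' SiegelUpperHalf g with hO
  have hbdd : BddAbove O := ⟨b, by rintro x ⟨Z, hZ, rfl⟩; exact hb Z hZ⟩
  set M := sSup O with hMdef
  have hM : ∀ Z ∈ SiegelUpperHalf g, petersson l F.toFun Z ≤ M :=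
    fun Z hZ => le_csSup hbdd ⟨Z, hZ, rfl⟩
  have hM0 : 0 < M := by
    obtain ⟨Z, hZ, hne⟩ := hF
    refine lt_of_lt_of_le ?_ (hM Z hZ)
    have hd : 0 < (imR Z).det := Matrix.PosDef.det_pos hZ.2
    have : 0 < ‖F.toFun Z‖ := norm_pos_iff.mpr hne
    rw [petersson]
    positivity
  have hne : O.Nonempty := by
    obtain ⟨Z, hZ, -⟩ := hF
    exact ⟨_, Z, hZ, rfl⟩
  obtain ⟨_, ⟨Z, hZ, rfl⟩, hZM⟩ := exists_lt_of_lt_csSup hne (half_lt_self hM0)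
  obtain ⟨Z₀, hrel, hred⟩ := exists_reduced hZ
  have hZ₀ := hrel.mem_upperHalf hZ
  rw [← hrel.petersson_eq F hZ] at hZM
  set R : ℕ := g * 2 ^ (g + 2) with hR
  have hR8 : 8 ≤ R := by
    have : 2 ^ 3 ≤ 2 ^ (g + 2) := Nat.pow_le_pow_right (by norm_num) (by omega)
    nlinarith
  have hR0 : (0 : ℝ) < R := by
    have : (8 : ℝ) ≤ R := by exact_mod_cast hR8
    linarith
  set ε : ℝ := (R : ℝ)⁻¹ with hε
  have hε0 : 0 < ε := by positivity
  have hY₀ : (imR Z₀).PosDef := hZ₀.2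
  have h2ε : (imR Z₀ - (2 * ε) • (1 : Matrix (Fin g) (Fin g) ℝ)).PosSemidef := by
    have h := hY₀.sub_inv_trace_smul_one (r := (R : ℝ) / 2) (by positivity) (by
      refine hred.trans (le_of_eq ?_)
      rw [hR]
      push_cast
      ring)
    rwa [show ((R : ℝ) / 2)⁻¹ = 2 * ε by rw [hε, inv_div]; ring] at h
  set Z₁ := Z₀ + (-((ε : ℂ) * Complex.I)) • (1 : Matrix (Fin g) (Fin g) ℂ) with hZ₁def
  have him : imR Z₁ = imR Z₀ - ε • (1 : Matrix (Fin g) (Fin g) ℝ) := by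
    ext i j
    by_cases hij : i = j <;> simp [hZ₁def, hij, sub_eq_add_neg]
  have hY₁ : (imR Z₁).PosDef := by
    have e : imR Z₁ = ε • (1 : Matrix (Fin g) (Fin g) ℝ) +
        (imR Z₀ - (2 * ε) • (1 : Matrix (Fin g) (Fin g) ℝ)) := by
      rw [him]; module
    rw [e]
    exact (Matrix.PosDef.one.smul hε0).add_posSemidef h2ε
  have hZ₁ : Z₁ ∈ SiegelUpperHalf g := by
    refine ⟨?_, hY₁⟩
    rw [IsSymm, hZ₁def, transpose_add, transpose_smul, transpose_one, hZ₀.1]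
  have hdet : (imR Z₀).det ≤ 2 ^ g * (imR Z₁).det := by
    have h := hY₀.det_le_det (A := (2 : ℝ) • imR Z₁) (by
      rw [show (2 : ℝ) • imR Z₁ - imR Z₀ =
        imR Z₀ - (2 * ε) • (1 : Matrix (Fin g) (Fin g) ℝ) by rw [him]; module]
      exact h2ε)
    rwa [det_smul, Fintype.card_fin] at h
  have hZ₀₁ : Z₀ = Z₁ + ((ε : ℂ) * Complex.I) • (1 : Matrix (Fin g) (Fin g) ℂ) := by
    rw [hZ₁def]; module
  set q := Real.exp (-(2 * Real.pi * ε)) with hq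
  have hq0 : 0 < q := Real.exp_pos _
  have hq1 : q < 1 := by
    rw [hq, Real.exp_lt_one_iff]
    have := Real.pi_pos
    simp only [Left.neg_neg_iff]
    positivity
  set A := M / (imR Z₁).det ^ l with hA
  have hd₁ := hY₁.det_pos
  have hA0 : 0 < A := by positivity
  have hcoef : ∀ n, ‖traceCoeff F Z₀ n‖ ≤ A * q ^ n := fun n => by
    rw [hZ₀₁, traceCoeff_add_smul_one, norm_mul, norm_cexp_mul_I]
    have : ((ε : ℂ) * Complex.I).im = ε := by simp
    rw [this]
    gcongr
    exact norm_traceCoeff_le F hF hM hZ₁ n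
  have hzero : ∀ n < m, traceCoeff F Z₀ n = 0 := fun n hn => by
    rw [traceCoeff]
    refine (tsum_congr fun T => ?_).trans tsum_zero
    rw [fourierTerm, hcon T.1 (by rw [T.2]; exact hn), zero_mul]
  have hsum := (hasSum_nat_add_iff' m).mpr (hasSum_traceCoeff F hF hZ₀)
  rw [Finset.sum_eq_zero (fun n hn => hzero n (Finset.mem_range.mp hn)), sub_zero] at hsum
  have hnorm : ‖F.toFun Z₀‖ ≤ A * (q ^ m * (1 - q)⁻¹) := by
    rw [← hsum.tsum_eq]
    refine tsum_of_norm_bounded (g := fun n => A * (q ^ m * q ^ n))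
      (((hasSum_geometric_of_lt_one hq0.le hq1).mul_left _).mul_left _) fun n => ?_
    rw [← pow_add, add_comm m]
    exact hcoef _
  have hfin : petersson l F.toFun Z₀ ≤ M * (2 ^ (g * l) * (q ^ m * (1 - q)⁻¹)) := by
    rw [petersson]
    have h1q : 0 < 1 - q := by linarith
    calc (imR Z₀).det ^ l * ‖F.toFun Z₀‖
        ≤ (2 ^ g * (imR Z₁).det) ^ l * (A * (q ^ m * (1 - q)⁻¹)) := by
          have := hY₀.det_pos
          gcongr
      _ = M * (2 ^ (g * l) * (q ^ m * (1 - q)⁻¹)) := by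
          rw [hA, mul_pow, ← pow_mul]
          field_simp
  have hnum := two_pow_mul_exp_le (N := g * l) hR8 hm
  rw [← hε, ← hq] at hnum
  nlinarith

end VanishingOrder

section SignChange

lemma exp_neg_pi_mul_le_half {y : ℝ} (hy : 1 / 2 ≤ y) : Real.exp (-(Real.pi * y)) ≤ 1 / 2 := by
  have h1 := Real.add_one_le_exp (Real.pi * y)
  have h2 := Real.pi_gt_three
  rw [Real.exp_neg, one_div]
  exact inv_anti₀ two_pos (by nlinarith)

lemma inv_one_sub_exp_le_two {y : ℝ} (hy : 1 / 2 ≤ y) :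
    (1 - Real.exp (-(Real.pi * y)))⁻¹ ≤ 2 := by
  have := exp_neg_pi_mul_le_half hy
  rw [inv_le_comm₀ (by linarith) two_pos]
  linarith

/-- A power series in `q = exp (2πiτ)` without constant term, converging on the upper half-plane
to a function `f` such that `(Im τ) ^ L * ‖f τ‖` is bounded by `M`. -/
structure IsBoundedCuspSeries (c : ℕ → ℂ) (f : ℂ → ℂ) (L : ℕ) (M : ℝ) : Prop where
  hasSum : ∀ τ : ℂ, 0 < τ.im →
    HasSum (fun n : ℕ => c n * Complex.exp (2 * Real.pi * Complex.I * n * τ)) (f τ)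
  coeff_zero : c 0 = 0
  bound : ∀ τ : ℂ, 0 < τ.im → τ.im ^ L * ‖f τ‖ ≤ M

namespace IsBoundedCuspSeries

variable {c : ℕ → ℂ} {f : ℂ → ℂ} {L : ℕ} {M : ℝ}

lemma nonneg (h : IsBoundedCuspSeries c f L M) : 0 ≤ M :=
  (mul_nonneg (by simp) (norm_nonneg (f Complex.I))).trans (h.bound Complex.I (by simp))

lemma norm_coeff_le (h : IsBoundedCuspSeries c f L M) {y : ℝ} (hy : 0 < y) (n : ℕ) :
    ‖c n‖ * Real.exp (-(2 * Real.pi * y)) ^ n ≤ M / y ^ L := by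
  have h0 := (h.hasSum (y * Complex.I) (by simpa using hy)).summable.norm
  have h1 := norm_coeff_le_of_hasSum (G := fun x : ℝ => f (y * Complex.I + x)) (S := M / y ^ L)
    h0 (fun x => by
      refine (h.hasSum (y * Complex.I + x) (by simpa using hy)).congr_fun fun m => ?_
      rw [mul_assoc, ← Complex.exp_add]
      congr 2
      ring) (fun x => by
      rw [le_div_iff₀' (by positivity)]
      simpa using h.bound (y * Complex.I + x) (by simpa using hy)) n
  rw [norm_mul, norm_cexp_mul_I] at h1
  simpa using h1

/-- The tail of the series at height `y`, estimated from the bound on the coefficients at height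
`y / 2`. -/
lemma norm_sub_sum_le (h : IsBoundedCuspSeries c f L M) {τ : ℂ} (hτ : 0 < τ.im) (m : ℕ) :
    ‖f τ - ∑ n ∈ Finset.range m, c n * Complex.exp (2 * Real.pi * Complex.I * n * τ)‖ ≤
      M * (2 / τ.im) ^ L * (Real.exp (-(Real.pi * τ.im)) ^ m *
        (1 - Real.exp (-(Real.pi * τ.im)))⁻¹) := by
  set r := Real.exp (-(Real.pi * τ.im)) with hr
  have hr0 : 0 ≤ r := (Real.exp_pos _).le
  have hr1 : r < 1 := by
    rw [hr, ← Real.exp_zero, Real.exp_lt_exp]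
    have := mul_pos Real.pi_pos hτ
    linarith
  have hterm : ∀ n : ℕ, ‖c n * Complex.exp (2 * Real.pi * Complex.I * n * τ)‖ ≤
      M * (2 / τ.im) ^ L * r ^ n := fun n => by
    have h1 := h.norm_coeff_le (half_pos hτ) n
    rw [show 2 * Real.pi * (τ.im / 2) = Real.pi * τ.im by ring, ← hr] at h1
    rw [norm_mul, norm_cexp_mul_I,
      show Real.exp (-(2 * Real.pi * τ.im)) = r * r by rw [hr, ← Real.exp_add]; congr 1; ring,
      mul_pow, ← mul_assoc]
    refine mul_le_mul_of_nonneg_right (h1.trans_eq ?_) (by positivity)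
    rw [div_eq_mul_inv, ← inv_pow, inv_div]
  have htail := (hasSum_nat_add_iff' m).mpr (h.hasSum τ hτ)
  have hgeom : HasSum (fun n : ℕ => M * (2 / τ.im) ^ L * (r ^ m * r ^ n))
      (M * (2 / τ.im) ^ L * (r ^ m * (1 - r)⁻¹)) :=
    ((hasSum_geometric_of_lt_one hr0 hr1).mul_left _).mul_left _
  rw [← htail.tsum_eq]
  refine tsum_of_norm_bounded hgeom fun n => ?_
  rw [← pow_add, add_comm m]
  exact hterm (n + m)

lemma norm_le (h : IsBoundedCuspSeries c f L M) {τ : ℂ} (hτ : 1 / 2 ≤ τ.im) :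
    ‖f τ‖ ≤ 2 * M * (2 / τ.im) ^ L * Real.exp (-(Real.pi * τ.im)) := by
  have h0 : 0 < τ.im := by linarith
  have h1 := h.norm_sub_sum_le h0 1
  simp only [Finset.range_one, Finset.sum_singleton, h.coeff_zero, zero_mul, sub_zero,
    pow_one] at h1
  refine h1.trans ?_
  have h2 := inv_one_sub_exp_le_two hτ
  have := h.nonneg
  calc _ ≤ M * (2 / τ.im) ^ L * (Real.exp (-(Real.pi * τ.im)) * 2) := by gcongr
    _ = _ := by ring

lemma im_le (h : IsBoundedCuspSeries c f L M) (hM : 0 < M) {z : ℂ} (hz : 1 / 2 ≤ z.im)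
    (hzM : M / 2 ≤ z.im ^ L * ‖f z‖) : z.im ≤ L + 2 := by
  have h0 : 0 < z.im := by linarith
  have h1 := h.norm_le hz
  have h2 : M / 2 ≤ 2 * M * 2 ^ L * Real.exp (-(Real.pi * z.im)) := by
    calc M / 2 ≤ z.im ^ L * ‖f z‖ := hzM
      _ ≤ z.im ^ L * (2 * M * (2 / z.im) ^ L * Real.exp (-(Real.pi * z.im))) := by gcongr
      _ = _ := by rw [div_pow]; field_simp
  rw [Real.exp_neg] at h2
  have h3 : Real.exp (Real.pi * z.im) ≤ 2 ^ (L + 2) := by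
    have h4 : 0 < Real.exp (Real.pi * z.im) := Real.exp_pos _
    rw [← div_eq_mul_inv, le_div_iff₀ h4] at h2
    rw [pow_add]
    nlinarith
  have h4 : (2 : ℝ) ^ (L + 2) ≤ Real.exp (L + 2) := by
    have := Real.add_one_le_exp (1 : ℝ)
    calc (2 : ℝ) ^ (L + 2) ≤ Real.exp 1 ^ (L + 2) := by gcongr; linarith
      _ = Real.exp (L + 2) := by rw [← Real.exp_nat_mul]; push_cast; rw [mul_one]
  have h5 := Real.exp_le_exp.mp (h3.trans h4)
  have := Real.pi_gt_three
  nlinarith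

/-- The initial segment of the series carries a definite part of its size at a point where the
invariant norm is nearly maximal. -/
lemma le_sum_norm (h : IsBoundedCuspSeries c f L M) {z : ℂ} (hz : 1 / 2 ≤ z.im)
    (hzM : M / 2 ≤ z.im ^ L * ‖f z‖) {m : ℕ} (hm : L + 3 ≤ m) :
    M / 4 ≤ z.im ^ L *
      ∑ n ∈ Finset.range m, ‖c n‖ * Real.exp (-(2 * Real.pi * z.im)) ^ n := by
  have h0 : 0 < z.im := by linarith
  have hM := h.nonneg
  have h1 := h.norm_sub_sum_le h0 m
  have h2 := norm_le_norm_sub_add (f z)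
    (∑ n ∈ Finset.range m, c n * Complex.exp (2 * Real.pi * Complex.I * n * z))
  have h3 : ‖∑ n ∈ Finset.range m, c n * Complex.exp (2 * Real.pi * Complex.I * n * z)‖ ≤
      ∑ n ∈ Finset.range m, ‖c n‖ * Real.exp (-(2 * Real.pi * z.im)) ^ n := by
    refine (norm_sum_le _ _).trans_eq (Finset.sum_congr rfl fun n _ => ?_)
    rw [norm_mul, norm_cexp_mul_I]
  have h4 : z.im ^ L * (M * (2 / z.im) ^ L * (Real.exp (-(Real.pi * z.im)) ^ m *
      (1 - Real.exp (-(Real.pi * z.im)))⁻¹)) ≤ M / 4 := by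
    have h5 := inv_one_sub_exp_le_two hz
    have h6 := exp_neg_pi_mul_le_half hz
    have h7 : 0 ≤ (1 - Real.exp (-(Real.pi * z.im)))⁻¹ := inv_nonneg.mpr (by linarith)
    calc _ = M * 2 ^ L * (Real.exp (-(Real.pi * z.im)) ^ m *
          (1 - Real.exp (-(Real.pi * z.im)))⁻¹) := by rw [div_pow]; field_simp
      _ ≤ M * 2 ^ L * ((1 / 2) ^ m * 2) := by gcongr
      _ ≤ M * 2 ^ L * ((1 / 2) ^ (L + 3) * 2) := by
        gcongr M * 2 ^ L * (?_ * 2)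
        exact pow_le_pow_of_le_one (by norm_num) (by norm_num) hm
      _ = M / 4 := by
        rw [one_div, inv_pow, pow_add]
        field_simp
        norm_num
  have h5 : z.im ^ L * ‖f z‖ ≤ z.im ^ L * (M * (2 / z.im) ^ L *
      (Real.exp (-(Real.pi * z.im)) ^ m * (1 - Real.exp (-(Real.pi * z.im)))⁻¹) +
      ∑ n ∈ Finset.range m, ‖c n‖ * Real.exp (-(2 * Real.pi * z.im)) ^ n) := by
    gcongr
    linarith
  rw [mul_add] at h5
  linarith

lemma sum_norm_le (h : IsBoundedCuspSeries c f L M) {t : ℝ} (ht : 0 < t) {m : ℕ}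
    (hc : ∀ n < m, c n = ‖c n‖) :
    ∑ n ∈ Finset.range m, ‖c n‖ * Real.exp (-(2 * Real.pi * t)) ^ n ≤
      ‖f (t * Complex.I)‖ + M * (2 / t) ^ L * (Real.exp (-(Real.pi * t)) ^ m *
        (1 - Real.exp (-(Real.pi * t)))⁻¹) := by
  have him : (t * Complex.I : ℂ).im = t := by simp
  have h1 := h.norm_sub_sum_le (τ := t * Complex.I) (by rw [him]; exact ht) m
  rw [him] at h1
  have h2 : ∑ n ∈ Finset.range m, c n * Complex.exp (2 * Real.pi * Complex.I * n * (t * Complex.I))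
      = ((∑ n ∈ Finset.range m, ‖c n‖ * Real.exp (-(2 * Real.pi * t)) ^ n : ℝ) : ℂ) := by
    push_cast
    refine Finset.sum_congr rfl fun n hn => ?_
    rw [← hc n (Finset.mem_range.mp hn), ← Complex.exp_nat_mul]
    congr 2
    linear_combination (2 * Real.pi * n * t : ℂ) * Complex.I_mul_I
  rw [h2] at h1
  have h3 := norm_le_norm_sub_add
    ((∑ n ∈ Finset.range m, ‖c n‖ * Real.exp (-(2 * Real.pi * t)) ^ n : ℝ) : ℂ) (f (t * Complex.I))
  rw [norm_sub_rev, Complex.norm_real] at h3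
  linarith [Real.le_norm_self (∑ n ∈ Finset.range m, ‖c n‖ * Real.exp (-(2 * Real.pi * t)) ^ n)]

/-- A series that is invariant under `τ ↦ -1/τ` on the imaginary axis cannot have a long initial
segment of non-negative coefficients. -/
lemma exists_ne_norm (h : IsBoundedCuspSeries c f L M) (hM : 0 < M)
    (hinv : ∀ y : ℝ, 0 < y → ‖f ((y⁻¹ : ℝ) * Complex.I)‖ = y ^ (2 * L) * ‖f (y * Complex.I)‖)
    {z : ℂ} (hz : 1 / 2 ≤ z.im) (hzM : M / 2 ≤ z.im ^ L * ‖f z‖) {m : ℕ}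
    (hm : 128 * (L + 2) ^ 4 ≤ m) : ∃ n < m, c n ≠ ‖c n‖ := by
  by_contra! hc
  set P : ℝ := L + 2 with hP
  have hP2 : 2 ≤ P := by rw [hP]; linarith [Nat.cast_nonneg (α := ℝ) L]
  have hLP : (L : ℝ) = P - 2 := by rw [hP]; ring
  set x : ℝ := 4 * P with hx
  set B : ℝ := x ^ 2 with hB
  have hx8 : 8 ≤ x := by linarith
  have hB64 : 64 ≤ B := by rw [hB]; nlinarith
  have hmP : 128 * P ^ 4 ≤ m := by rw [hP]; exact_mod_cast hm
  have hmL : L + 3 ≤ m := by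
    refine le_trans ?_ hm
    calc L + 3 ≤ 128 * (L + 2) := by omega
      _ ≤ 128 * (L + 2) ^ 4 := by gcongr; exact Nat.le_self_pow (by norm_num) _
  have hpi := Real.pi_gt_three
  have hz0 : 0 < z.im := by linarith
  have hzP : z.im ≤ P := h.im_le hM hz hzM
  have ht : 0 < B⁻¹ := by positivity
  have hlow : M / 4 ≤ P ^ L *
      ∑ n ∈ Finset.range m, ‖c n‖ * Real.exp (-(2 * Real.pi * B⁻¹)) ^ n := by
    refine (h.le_sum_norm hz hzM hmL).trans ?_
    have hBz : B⁻¹ ≤ z.im := by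
      refine le_trans ?_ hz
      rw [one_div]
      exact inv_anti₀ two_pos (by linarith)
    gcongr
  have hup := h.sum_norm_le ht hc
  rw [hinv B (by positivity)] at hup
  have hfB : ‖f (B * Complex.I)‖ ≤ 2 * M * Real.exp (-(3 * B)) := by
    have h1 := h.norm_le (τ := B * Complex.I) (by simp; linarith)
    simp only [Complex.mul_im, Complex.ofReal_re, Complex.I_im, mul_one, Complex.ofReal_im,
      Complex.I_re, mul_zero, add_zero] at h1
    refine h1.trans ?_
    have h2 : (2 / B) ^ L ≤ 1 :=
      pow_le_one₀ (by positivity) ((div_le_one (by linarith)).mpr (by linarith))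
    have h3 : Real.exp (-(Real.pi * B)) ≤ Real.exp (-(3 * B)) := by gcongr
    calc _ ≤ 2 * M * 1 * Real.exp (-(3 * B)) := by gcongr
      _ = _ := by ring
  have htail : Real.exp (-(Real.pi * B⁻¹)) ^ m * (1 - Real.exp (-(Real.pi * B⁻¹)))⁻¹ ≤
      Real.exp (-(24 * P ^ 2)) * (2 * B) := by
    have h1 : Real.exp (-(Real.pi * B⁻¹)) ^ m ≤ Real.exp (-(24 * P ^ 2)) := by
      rw [← Real.exp_nat_mul, Real.exp_le_exp]
      have h2 : 24 * P ^ 2 ≤ m * (3 * B⁻¹) := by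
        rw [← mul_assoc, ← div_eq_mul_inv, le_div_iff₀ (by positivity), hB, hx]
        nlinarith
      have h3 : (m : ℝ) * (3 * B⁻¹) ≤ m * (Real.pi * B⁻¹) := by gcongr
      linarith
    have h2 : (1 - Real.exp (-(Real.pi * B⁻¹)))⁻¹ ≤ 2 * B := by
      have h3 := Real.add_one_le_exp (Real.pi * B⁻¹)
      have h4 : 3 * B⁻¹ ≤ Real.pi * B⁻¹ := by gcongr
      have h5 : Real.exp (-(Real.pi * B⁻¹)) ≤ (1 + 3 * B⁻¹)⁻¹ := by
        rw [Real.exp_neg]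
        exact inv_anti₀ (by positivity) (by linarith)
      have h6 : (2 * B)⁻¹ ≤ 1 - (1 + 3 * B⁻¹)⁻¹ := by
        rw [show 1 - (1 + 3 * B⁻¹)⁻¹ = 3 / (B + 3) by field_simp; ring,
          inv_eq_one_div, div_le_div_iff₀ (by positivity) (by positivity)]
        linarith
      rw [inv_le_comm₀ (lt_of_lt_of_le (by positivity) (h6.trans (by linarith))) (by positivity)]
      linarith
    have h0 : Real.exp (-(Real.pi * B⁻¹)) < 1 := by
      rw [← Real.exp_zero, Real.exp_lt_exp]
      have := mul_pos Real.pi_pos ht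
      linarith
    have : 0 ≤ (1 - Real.exp (-(Real.pi * B⁻¹)))⁻¹ := inv_nonneg.mpr (by linarith)
    gcongr
  have hxexp : ∀ j k : ℕ, (j : ℝ) ≤ k * P → x ^ j ≤ Real.exp (4 * k * P ^ 2) := fun j k hjk => by
    have h1 := Real.add_one_le_exp x
    calc x ^ j ≤ Real.exp x ^ j := by gcongr; linarith
      _ = Real.exp (j * x) := by rw [← Real.exp_nat_mul]
      _ ≤ _ := by
        rw [Real.exp_le_exp, hx]
        nlinarith
  have hsmall : ∀ u : ℝ, 32 ≤ u → Real.exp (-u) ≤ 1 / 64 := fun u hu => by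
    have h1 := Real.quadratic_le_exp_of_nonneg (x := u) (by linarith)
    rw [Real.exp_neg, one_div]
    exact inv_anti₀ (by norm_num) (by nlinarith)
  have hfirst : P ^ L * B ^ (2 * L) * Real.exp (-(3 * B)) ≤ 1 / 64 := by
    have h1 : P ^ L * B ^ (2 * L) ≤ Real.exp (20 * P ^ 2) := by
      calc P ^ L * B ^ (2 * L) ≤ x ^ L * B ^ (2 * L) := by gcongr; linarith
        _ = x ^ (5 * L) := by rw [hB, ← pow_mul, ← pow_add]; congr 1; ring
        _ ≤ Real.exp (4 * (5 : ℕ) * P ^ 2) := hxexp _ _ (by push_cast; linarith)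
        _ = _ := by norm_num
    calc _ ≤ Real.exp (20 * P ^ 2) * Real.exp (-(3 * B)) := by gcongr
      _ = Real.exp (-(28 * P ^ 2)) := by rw [← Real.exp_add, hB, hx]; congr 1; ring
      _ ≤ 1 / 64 := hsmall _ (by nlinarith)
  have hsecond : P ^ L * (2 * B) ^ (L + 1) * Real.exp (-(24 * P ^ 2)) ≤ 1 / 64 := by
    have h1 : P ^ L * (2 * B) ^ (L + 1) ≤ Real.exp (16 * P ^ 2) := by
      have h2 : 2 * B ≤ x ^ 3 := by rw [hB]; nlinarith [sq_nonneg x]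
      calc P ^ L * (2 * B) ^ (L + 1) ≤ x ^ L * (x ^ 3) ^ (L + 1) := by gcongr; linarith
        _ = x ^ (4 * L + 3) := by rw [← pow_mul, ← pow_add]; congr 1; ring
        _ ≤ Real.exp (4 * (4 : ℕ) * P ^ 2) := hxexp _ _ (by push_cast; linarith)
        _ = _ := by norm_num
    calc _ ≤ Real.exp (16 * P ^ 2) * Real.exp (-(24 * P ^ 2)) := by gcongr
      _ = Real.exp (-(8 * P ^ 2)) := by rw [← Real.exp_add]; congr 1; ring
      _ ≤ 1 / 64 := hsmall _ (by nlinarith)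
  have hfinal : M / 4 ≤ 2 * M * (P ^ L * B ^ (2 * L) * Real.exp (-(3 * B))) +
      M * (P ^ L * (2 * B) ^ (L + 1) * Real.exp (-(24 * P ^ 2))) := by
    refine hlow.trans ?_
    calc
      _ ≤ P ^ L * (B ^ (2 * L) * (2 * M * Real.exp (-(3 * B))) +
          M * (2 / B⁻¹) ^ L * (Real.exp (-(24 * P ^ 2)) * (2 * B))) := by
        refine mul_le_mul_of_nonneg_left (hup.trans ?_) (by positivity)
        gcongr
      _ = _ := by rw [div_inv_eq_mul, pow_succ]; ring
  nlinarith [mul_le_mul_of_nonneg_left hfirst hM.le, mul_le_mul_of_nonneg_left hsecond hM.le]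

end IsBoundedCuspSeries

end SignChange

section Diagonal

variable {g k : ℕ}

lemma smul_one_mem {τ : ℂ} (hτ : 0 < τ.im) :
    τ • (1 : Matrix (Fin g) (Fin g) ℂ) ∈ SiegelUpperHalf g := by
  refine ⟨by rw [IsSymm, transpose_smul, transpose_one], ?_⟩
  rw [show (τ • (1 : Matrix (Fin g) (Fin g) ℂ)).map Complex.im = τ.im • 1 from imR_smul_one τ]
  exact PosDef.one.smul hτ

lemma petersson_smul_one {l : ℕ} (f : Matrix (Fin g) (Fin g) ℂ → ℂ) (τ : ℂ) :
    petersson l f (τ • 1) = τ.im ^ (g * l) * ‖f (τ • 1)‖ := by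
  rw [petersson, imR_smul_one, det_smul, det_one, mul_one, Fintype.card_fin, pow_mul]

/-- The diagonal embedding of `SL₂(ℤ)` into the symplectic group. -/
lemma spRel_smul_one {a b c d : ℤ} (h : a * d - b * c = 1) {τ τ' : ℂ}
    (hτ : a * τ + b = τ' * (c * τ + d)) :
    SpRel (τ • (1 : Matrix (Fin g) (Fin g) ℂ)) (τ' • 1) := by
  have hC : ∀ n : ℤ, intC (n • (1 : Matrix (Fin g) (Fin g) ℤ)) = (n : ℂ) • 1 := fun n => by
    ext i j
    simp only [map_apply, Matrix.smul_apply, Matrix.one_apply, smul_eq_mul]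
    split_ifs <;> simp
  refine ⟨a • 1, b • 1, c • 1, d • 1, ?_, ?_⟩
  · rw [SymplecticGroup.fromBlocks_mem_iff]
    simp only [transpose_smul, transpose_one, smul_mul_smul_comm, Matrix.mul_one, ← sub_smul]
    refine ⟨by rw [mul_comm], by rw [mul_comm], ?_⟩
    rw [show a * d - c * b = 1 by linarith, one_smul]
  · simp only [hC, smul_mul_smul_comm, Matrix.mul_one, ← add_smul]
    rw [hτ]

/-- The restriction of a Siegel cusp form to the diagonal is given by a bounded series. -/
lemma isBoundedCuspSeries_traceCoeff {l : ℕ} (hg : 0 < g) (F : SiegelCuspForm g (2 * l))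
    (hF : ∃ Z ∈ SiegelUpperHalf g, F.toFun Z ≠ 0) {M : ℝ}
    (hM : ∀ τ : ℂ, 0 < τ.im → petersson l F.toFun (τ • 1) ≤ M) :
    IsBoundedCuspSeries (traceCoeff F 0) (fun τ => F.toFun (τ • 1)) (g * l) M where
  hasSum τ hτ := by
    refine (hasSum_traceCoeff F hF (smul_one_mem hτ)).congr_fun fun n => ?_
    rw [← traceCoeff_add_smul_one, zero_add]
  coeff_zero := by
    have : IsEmpty {T : HalfInt g // T.tr = 0} := ⟨fun T => by
      have : Nonempty (Fin g) := ⟨⟨0, hg⟩⟩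
      have h1 := T.1.2.2.1.trace_pos
      rw [T.1.tr_eq, T.2] at h1
      simp at h1⟩
    exact tsum_empty
  bound τ hτ := by
    rw [← petersson_smul_one]
    exact hM τ hτ

lemma IsBoundedCuspSeries.pos {c : ℕ → ℂ} {f : ℂ → ℂ} {L : ℕ} {M : ℝ}
    (h : IsBoundedCuspSeries c f L M) {n : ℕ} (hn : c n ≠ 0) : 0 < M := by
  have h1 := h.norm_coeff_le one_pos n
  rw [one_pow, div_one] at h1
  exact lt_of_lt_of_le (by positivity) h1

lemma traceCoeff_zero_eq (F : SiegelCuspForm g k) (n : ℕ) :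
    traceCoeff F 0 n = ∑' T : {T : HalfInt g // T.tr = n}, F.coeff T.1.1 :=
  tsum_congr fun T => by simp [fourierTerm]

lemma summable_coeff_of_tr_eq (F : SiegelCuspForm g k)
    (hF : ∃ Z ∈ SiegelUpperHalf g, F.toFun Z ≠ 0) (n : ℕ) :
    Summable fun T : {T : HalfInt g // T.tr = n} => F.coeff T.1.1 := by
  have h1 := (summable_fourierTerm F hF (smul_one_mem (τ := Complex.I) (by simp))).comp_injective
    (i := fun T : {T : HalfInt g // T.tr = n} => T.1) Subtype.val_injective
  refine (summable_mul_right_iff (Complex.exp_ne_zero (2 * Real.pi * Complex.I * n * Complex.I))).mp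
    (h1.congr fun T => ?_)
  have h2 := fourierTerm_add_smul_one F 0 Complex.I T.1
  rw [zero_add, T.2] at h2
  rw [Function.comp_apply, h2]
  simp [fourierTerm]

/-- A Siegel cusp form with real coefficients has a negative coefficient of small trace. -/
theorem exists_coeff_neg {l m : ℕ} (hg : 0 < g) (F : SiegelCuspForm g (2 * l))
    (hF : ∃ Z ∈ SiegelUpperHalf g, F.toFun Z ≠ 0)
    (hreal : ∀ T : HalfInt g, (F.coeff T.1).im = 0)
    (hm : g * 2 ^ (g + 2) * (g * l + g * 2 ^ (g + 2)) ≤ m)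
    (hm' : 128 * (g * l + 2) ^ 4 ≤ m) : ∃ T : HalfInt g, T.tr < m ∧ (F.coeff T.1).re < 0 := by
  by_contra! hneg
  have hcoe : ∀ T : HalfInt g, F.coeff T.1 = ((F.coeff T.1).re : ℂ) := fun T =>
    Complex.ext rfl (by rw [hreal T, Complex.ofReal_im])
  have htr : ∀ n, traceCoeff F 0 n =
      ((∑' T : {T : HalfInt g // T.tr = n}, (F.coeff T.1.1).re : ℝ) : ℂ) := fun n => by
    rw [traceCoeff_zero_eq, Complex.ofReal_tsum]
    exact tsum_congr fun T => hcoe T.1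
  have hnn : ∀ n < m, ∀ T : {T : HalfInt g // T.tr = n}, 0 ≤ (F.coeff T.1.1).re :=
    fun n hn T => hneg T.1 (by rw [T.2]; exact hn)
  obtain ⟨T₀, hT₀, hT₀'⟩ := exists_coeff_ne_zero hg F hF hm
  have hne : traceCoeff F 0 T₀.tr ≠ 0 := by
    rw [htr, Complex.ofReal_ne_zero]
    have hs : Summable fun T : {T : HalfInt g // T.tr = T₀.tr} => (F.coeff T.1.1).re :=
      (Complex.hasSum_re (summable_coeff_of_tr_eq F hF T₀.tr).hasSum).summable
    refine ne_of_gt (lt_of_lt_of_le ?_ (hs.le_tsum ⟨T₀, rfl⟩ fun T _ => hnn _ hT₀ T))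
    refine lt_of_le_of_ne (hneg T₀ hT₀) fun h => hT₀' ?_
    rw [hcoe T₀, ← h, Complex.ofReal_zero]
  obtain ⟨b, hb⟩ := exists_petersson_le hg F hF
  set A : Set ℝ := (fun τ : ℂ => petersson l F.toFun (τ • 1)) '' {τ | 0 < τ.im} with hA
  have hbdd : BddAbove A := ⟨b, by
    rintro _ ⟨τ, hτ, rfl⟩
    exact hb _ (smul_one_mem hτ)⟩
  have hser := isBoundedCuspSeries_traceCoeff hg F hF (M := sSup A) fun τ hτ =>
    le_csSup hbdd ⟨τ, hτ, rfl⟩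
  have hpos := hser.pos hne
  obtain ⟨_, ⟨τ, hτ, rfl⟩, hτM⟩ := exists_lt_of_lt_csSup
    (s := A) ⟨_, Complex.I, by simp, rfl⟩ (half_lt_self hpos)
  obtain ⟨γ, hγ⟩ := ModularGroup.exists_one_half_le_im_smul ⟨τ, hτ⟩
  set z : ℂ := ((γ • (⟨τ, hτ⟩ : UpperHalfPlane) : UpperHalfPlane) : ℂ) with hz
  have hrel : SpRel (τ • (1 : Matrix (Fin g) (Fin g) ℂ)) (z • 1) := by
    have hdet := Matrix.det_fin_two (γ : Matrix (Fin 2) (Fin 2) ℤ)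
    rw [γ.det_coe] at hdet
    refine spRel_smul_one hdet.symm ?_
    have hz' := UpperHalfPlane.coe_specialLinearGroup_apply γ ⟨τ, hτ⟩
    simp only [algebraMap_int_eq, eq_intCast, Complex.ofReal_intCast, ← hz] at hz'
    refine (eq_div_iff fun h0 => ?_).mp hz' |>.symm
    rw [h0, div_zero] at hz'
    have := UpperHalfPlane.im_pos (γ • (⟨τ, hτ⟩ : UpperHalfPlane))
    rw [← UpperHalfPlane.coe_im, ← hz, hz', Complex.zero_im] at this
    exact this.false
  have hzM : sSup A / 2 ≤ z.im ^ (g * l) * ‖F.toFun (z • 1)‖ := by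
    rw [← petersson_smul_one, hrel.petersson_eq F (smul_one_mem hτ)]
    exact hτM.le
  have hinv : ∀ y : ℝ, 0 < y → ‖F.toFun ((((y⁻¹ : ℝ) : ℂ) * Complex.I) • 1)‖ =
      y ^ (2 * (g * l)) * ‖F.toFun (((y : ℂ) * Complex.I) • 1)‖ := fun y hy => by
    have h1 : SpRel (((y : ℂ) * Complex.I) • (1 : Matrix (Fin g) (Fin g) ℂ))
        ((((y⁻¹ : ℝ) : ℂ) * Complex.I) • 1) := by
      refine spRel_smul_one (a := 0) (b := -1) (c := 1) (d := 0) (by norm_num) ?_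
      have : (y : ℂ) ≠ 0 := by exact_mod_cast hy.ne'
      push_cast
      field_simp
      linear_combination (-(y : ℂ)) * Complex.I_mul_I
    have h2 := h1.petersson_eq F (scalar_mem hy)
    rw [petersson_smul_one, petersson_smul_one] at h2
    simp only [Complex.mul_im, Complex.ofReal_re, Complex.I_im, mul_one, Complex.ofReal_im,
      Complex.I_re, mul_zero, add_zero, inv_pow] at h2
    rw [inv_mul_eq_iff_eq_mul₀ (by positivity)] at h2
    rw [h2]
    ring
  obtain ⟨n, hn, hn'⟩ := hser.exists_ne_norm hpos hinv hγ hzM hm'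
  refine hn' ?_
  rw [htr, Complex.norm_of_nonneg (tsum_nonneg (hnn n hn))]

end Diagonal

section Conclusion

variable {g k : ℕ}

/-- The negative of a Siegel cusp form. -/
def SiegelCuspForm.neg (F : SiegelCuspForm g k) : SiegelCuspForm g k where
  toFun Z := -F.toFun Z
  coeff T := -F.coeff T
  holo := F.holo.neg
  transform A B C D h Z hZ := by rw [F.transform A B C D h Z hZ, mul_neg]
  fourier Z hZ := by
    rw [F.fourier Z hZ, ← tsum_neg]
    exact tsum_congr fun T => (neg_mul _ _).symm

lemma le_siegelConst {g : ℕ} : (g : ℝ) * 2 ^ (g - 1) ≤ siegelConst g :=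
  le_mul_of_one_le_right (by positivity) (one_le_pow₀ (by norm_num))

lemma trace_bound_le {g l : ℕ} (hg : 2 ≤ g) (hl : 0 < l) :
    ((g * 2 ^ (g + 2) * (g * l + g * 2 ^ (g + 2)) + 128 * (g * l + 2) ^ 4 : ℕ) : ℝ) ≤
      3000 * (((2 * l : ℕ) : ℝ) * siegelConst g) ^ 5 *
        Real.log (((2 * l : ℕ) : ℝ) * siegelConst g) ^ 26 := by
  set N : ℝ := ((2 * l : ℕ) : ℝ) * siegelConst g with hN
  set G : ℝ := (g : ℝ) * 2 ^ (g - 1) with hG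
  have hg' : (2 : ℝ) ≤ g := by exact_mod_cast hg
  have hl' : (1 : ℝ) ≤ l := by exact_mod_cast hl
  have hpow : (2 : ℝ) ≤ 2 ^ (g - 1) := by
    simpa using pow_le_pow_right₀ (one_le_two (α := ℝ)) (show 1 ≤ g - 1 by omega)
  have hgG : 2 * g ≤ G := by rw [hG]; nlinarith
  have hlN : 2 * l * G ≤ N := by
    rw [hN]
    push_cast
    gcongr
    exact le_siegelConst
  have hR : (g : ℝ) * 2 ^ (g + 2) = 8 * G := by
    rw [hG, show g + 2 = (g - 1) + 3 by omega, pow_add]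
    ring
  have hGN : 2 * G ≤ N := by nlinarith
  have hN8 : 8 ≤ N := by linarith
  have hglN : (g : ℝ) * l ≤ N := by nlinarith
  have hlog : 1 ≤ Real.log N := by
    rw [Real.le_log_iff_exp_le (by linarith)]
    linarith [Real.exp_one_lt_d9]
  have hsum : ((g * 2 ^ (g + 2) * (g * l + g * 2 ^ (g + 2)) + 128 * (g * l + 2) ^ 4 : ℕ) : ℝ) ≤
      3000 * N ^ 5 := by
    push_cast
    rw [hR]
    have h1 : 8 * G * (g * l + 8 * G) ≤ 4 * N * (N + 4 * N) :=
      mul_le_mul (by linarith) (by linarith) (by positivity) (by linarith)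
    have h2 : 128 * ((g : ℝ) * l + 2) ^ 4 ≤ 128 * (2 * N) ^ 4 := by gcongr; linarith
    have h3 : N ^ 2 ≤ N ^ 5 := pow_le_pow_right₀ (by linarith) (by norm_num)
    have h4 : N ^ 4 ≤ N ^ 5 := pow_le_pow_right₀ (by linarith) (by norm_num)
    have h5 : 0 ≤ N ^ 5 := by positivity
    nlinarith
  exact hsum.trans (le_mul_of_one_le_right (by positivity) (one_le_pow₀ hlog))

lemma exists_coeff_neg_of_even {k : ℕ} (hg : 2 ≤ g) (hk : 0 < k) (hk' : Even k)
    (F : SiegelCuspForm g k) (hF : ∃ Z ∈ SiegelUpperHalf g, F.toFun Z ≠ 0)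
    (hreal : ∀ T : Matrix (Fin g) (Fin g) ℝ, IsPDHalfIntegral T → (F.coeff T).im = 0) :
    ∃ T : Matrix (Fin g) (Fin g) ℝ, IsPDHalfIntegral T ∧
      T.trace ≤ 3000 * ((k : ℝ) * siegelConst g) ^ 5 *
        Real.log ((k : ℝ) * siegelConst g) ^ 26 ∧ (F.coeff T).re < 0 := by
  obtain ⟨l, rfl⟩ := even_iff_exists_two_mul.mp hk'
  obtain ⟨T, hT, hneg⟩ := exists_coeff_neg (by omega) F hF (fun T => hreal T.1 T.2)
    (Nat.le_add_right _ (128 * (g * l + 2) ^ 4)) (Nat.le_add_left _ _)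
  refine ⟨T.1, T.2, le_trans ?_ (trace_bound_le hg (l := l) (by omega)), hneg⟩
  rw [T.tr_eq]
  exact_mod_cast hT.le

end Conclusion

/-- **Theorem.** There is an absolute effective constant `C > 0` such that for every `g ≥ 2`,
every even `k > 0` and every non-zero Siegel cusp form `F` of weight `k` on `Sp_g(ℤ)` with real
Fourier coefficients, there are positive definite half-integral `T₁, T₂` of trace at most
`C·(k·c_g)^5·log(k·c_g)^26` with `a(T₁) > 0` and `a(T₂) < 0`. -/
theorem first_sign_change_siegel :
    ∃ C : ℝ, 0 < C ∧ ∀ (g k : ℕ), 2 ≤ g → 0 < k → Even k →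
      ∀ F : SiegelCuspForm g k,
        (∃ Z ∈ SiegelUpperHalf g, F.toFun Z ≠ 0) →
        (∀ T : Matrix (Fin g) (Fin g) ℝ, IsPDHalfIntegral T → (F.coeff T).im = 0) →
        ∃ T₁ T₂ : Matrix (Fin g) (Fin g) ℝ,
          IsPDHalfIntegral T₁ ∧ IsPDHalfIntegral T₂ ∧
          T₁.trace ≤ C * ((k : ℝ) * siegelConst g) ^ 5 *
            Real.log ((k : ℝ) * siegelConst g) ^ 26 ∧
          T₂.trace ≤ C * ((k : ℝ) * siegelConst g) ^ 5 *
            Real.log ((k : ℝ) * siegelConst g) ^ 26 ∧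
          0 < (F.coeff T₁).re ∧ (F.coeff T₂).re < 0 := by
  refine ⟨3000, by norm_num, fun g k hg hk hk' F hF hreal => ?_⟩
  obtain ⟨T₁, h₁, ht₁, hpos⟩ := exists_coeff_neg_of_even hg hk hk' F.neg
    (hF.imp fun Z hZ => ⟨hZ.1, neg_ne_zero.mpr hZ.2⟩)
    (fun T hT => by rw [SiegelCuspForm.neg, Complex.neg_im, hreal T hT, neg_zero])
  obtain ⟨T₂, h₂, ht₂, hneg⟩ := exists_coeff_neg_of_even hg hk hk' F hF hreal
  exact ⟨T₁, T₂, h₁, h₂, ht₁, ht₂, neg_lt_zero.mp hpos, hneg⟩
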